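/- The van der Waerden number w(6,4,2;3) equals 83. That is, every 3-coloring of {1,...,83} with colors 0, 1, 2 contains a 6-term arithmetic progression of color 0, a 4-term arithmetic progression of color 1, or a 2-term arithmetic progression of color 2, and 83 is the least positive integer with this property. -/

import Mathlib

/-- `vdwProp r k n` says: every coloring `χ` of `{1,...,n}` with colors `0,...,r-1`
admits, for some color `i < r`, a `k i`-term arithmetic progression
`a, a+d, ..., a+(k i - 1)d` (with `a ≥ 1`, `d ≥ 1`) contained in `{1,...,n}`,
all of whose elements have color `i`. -/
def vdwProp (r : ℕ) (k : ℕ → ℕ) (n : ℕ) : Prop :=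
  ∀ χ : ℕ → ℕ, (∀ x, 1 ≤ x → x ≤ n → χ x < r) →
    ∃ i < r, ∃ a, 1 ≤ a ∧ ∃ d, 1 ≤ d ∧ a + (k i - 1) * d ≤ n ∧
      ∀ t < k i, χ (a + t * d) = i

/-! ### A breadth-first search on bit-packed partial colorings

A partial coloring of the positions `0, 1, 2, …` by two colors is a *lane*. A batch of `N` lanes is
stored in two natural numbers `A` and `B`: bit `x * N + i` of `A` (of `B`) says that lane `i` gives
position `x` the color `0` (the color `1`). All lanes of a batch are processed simultaneously by
bitwise operations. The search is run by the kernel, so the definitions below are stated with the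
accelerated functions on `ℕ` and with recursors. -/

namespace Lanes

/-- The number whose lowest `n` bits are set. -/
def ones (n : ℕ) : ℕ := Nat.sub (Nat.shiftLeft 1 n) 1

/-- The bits of `a` that are not bits of `b`. -/
def removeBits (a b : ℕ) : ℕ := Nat.xor a (Nat.land a b)

/-- The positions that complete a `6`-term progression with difference `d`, the other terms of which
lie in `A`; the result is shifted to the left by `5 * d` blocks. -/
def sixRule (N A d : ℕ) : ℕ :=
  let s := Nat.mul d N
  let P := Nat.land A (Nat.shiftLeft A s)
  let A₂ := Nat.shiftLeft A (Nat.mul 2 s)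
  let Q := Nat.land P (Nat.shiftLeft P (Nat.mul 2 s))
  let R := Nat.land P A₂
  let F := Nat.land Q (Nat.shiftLeft A (Nat.mul 4 s))
  Nat.lor (Nat.shiftLeft (Nat.lor (Nat.shiftLeft (Nat.lor (Nat.shiftLeft (Nat.lor
    (Nat.shiftLeft (Nat.lor (Nat.shiftLeft (Nat.shiftLeft F s) s)
      (Nat.land A (Nat.shiftLeft Q (Nat.mul 2 s)))) s)
      (Nat.land P (Nat.shiftLeft R (Nat.mul 3 s)))) s)
      (Nat.land R (Nat.shiftLeft P (Nat.mul 4 s)))) s)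
      (Nat.land Q (Nat.shiftLeft A (Nat.mul 5 s)))) s) F

/-- The positions that complete a `4`-term progression with difference `d`, the other terms of which
lie in `B`; the result is shifted to the left by `3 * d` blocks. -/
def fourRule (N B d : ℕ) : ℕ :=
  let s := Nat.mul d N
  let B₁ := Nat.shiftLeft B s
  let B₂ := Nat.shiftLeft B (Nat.mul 2 s)
  let B₃ := Nat.shiftLeft B (Nat.mul 3 s)
  let C := Nat.land B B₁
  let D := Nat.land B₂ B₃
  Nat.lor (Nat.shiftLeft (Nat.lor (Nat.shiftLeft (Nat.lor (Nat.shiftLeft (Nat.land B₁ D) s)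
    (Nat.land B D)) s) (Nat.land C B₃)) s) (Nat.land C B₂)

/-- The union over `1 ≤ d ≤ n` of the numbers `f d`, each shifted to the right by `d * w`. -/
noncomputable def unionUpTo (w : ℕ) (f : ℕ → ℕ) (n : ℕ) : ℕ :=
  Nat.shiftRight
    (Nat.rec 0 (fun d acc => Nat.lor (Nat.shiftLeft acc w) (f (Nat.succ d))) n) (Nat.mul n w)

/-- The largest left end of a window. -/
noncomputable def lower (ws : List (ℕ × ℕ)) : ℕ :=
  List.rec 0 (fun w _ ih => cond (Nat.ble w.1 ih) ih w.1) ws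

/-- The smallest right end of a window, and at most `M`. -/
noncomputable def upper (M : ℕ) (ws : List (ℕ × ℕ)) : ℕ :=
  List.rec M (fun w _ ih => cond (Nat.ble ih w.2) ih w.2) ws

/-- The bits of the positions, other than `h`, that lie in all windows. -/
noncomputable def validMask (M h : ℕ) (ws : List (ℕ × ℕ)) (N : ℕ) : ℕ :=
  removeBits (removeBits (ones (Nat.mul (upper M ws) N)) (ones (Nat.mul (lower ws) N)))
    (Nat.shiftLeft (ones N) (Nat.mul h N))

/-- The union of the first `128` blocks of `C`. -/
noncomputable def foldBlocks (N C : ℕ) : ℕ :=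
  Nat.shiftRight (Nat.rec C (fun i C => Nat.lor C (Nat.shiftLeft C (Nat.mul (Nat.pow 2 i) N))) 7)
   (Nat.mul 127 N)

/-- The prefix parities of the bits of `m`. -/
noncomputable def prefixXor (m h : ℕ) : ℕ :=
  Nat.rec m (fun h acc => Nat.xor acc (Nat.shiftLeft acc (Nat.pow 2 h))) h

/-- Move the bits of `b` in the mask `mv` down by `k`. -/
def moveBits (k mv b : ℕ) : ℕ :=
  let t := Nat.land b mv
  Nat.lor (Nat.xor b t) (Nat.shiftRight t k)

/-- The moves that gather the bits of `m` at the lowest positions by the parallel-suffix method;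
`mk` is the complement of `m` shifted by one. -/
noncomputable def squeezePlan (h n : ℕ) : ℕ → ℕ → ℕ → List (ℕ × ℕ) :=
  Nat.rec (fun _ _ _ => [])
    (fun _ ih k m mk =>
      let mp := prefixXor mk h
      let mv := Nat.land mp m
      (k, mv) :: ih (Nat.mul 2 k) (moveBits k mv m) (removeBits mk mp)) n

/-- Perform a list of moves. -/
noncomputable def applyMoves (l : List (ℕ × ℕ)) (b : ℕ) : ℕ :=
  List.rec (fun b => b) (fun p _ ih b => ih (moveBits p.1 p.2 b)) l b

/-- The moves, applied to `m`, neither merge bits nor drop them below position `0`. -/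
noncomputable def movesOk (l : List (ℕ × ℕ)) (m : ℕ) : Bool :=
  List.rec (fun _ => true) (fun p _ ih m =>
    cond (Nat.beq (Nat.shiftLeft (Nat.shiftRight p.2 p.1) p.1) p.2)
      (cond (Nat.beq (removeBits p.2 m) 0)
        (cond (Nat.beq (Nat.land (Nat.shiftRight p.2 p.1) (removeBits m p.2)) 0)
          (ih (moveBits p.1 p.2 m)) false) false) false) l m

/-- `2 ^ h` runs of `w` set bits, starting at the multiples of `G`. -/
noncomputable def stripes (w G h : ℕ) : ℕ :=
  Nat.rec (ones w) (fun i acc => Nat.lor acc (Nat.shiftLeft acc (Nat.mul (Nat.pow 2 i) G))) h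

/-- Move the upper halves of the groups of `2 ^ (j + 1)` blocks so that `2 ^ j * N` becomes
`2 ^ j * N'` as the distance of the halves; `a` and `b` are the minimum and the maximum of `N`
and `N'`. -/
noncomputable def restrideStep (N N' a b j A : ℕ) : ℕ :=
  let p := Nat.pow 2 j
  let E := stripes (Nat.mul p a) (Nat.mul (Nat.mul 2 p) b) (Nat.sub 6 j)
  let U := Nat.land A (Nat.shiftLeft E (Nat.mul p N))
  Nat.lor (Nat.land A E)
    (cond (Nat.ble N' N) (Nat.shiftRight U (Nat.mul p (Nat.sub N N')))
      (Nat.shiftLeft U (Nat.mul p (Nat.sub N' N))))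

/-- Change the block length of a batch from `N` to `N'`. -/
noncomputable def restride (N N' A : ℕ) : ℕ :=
  cond (Nat.ble N' N)
    (Nat.rec A (fun j acc => restrideStep N N' N' N j acc) 7)
    (Nat.rec (fun A => A) (fun j ih A => ih (restrideStep N N' N N' j A)) 7 A)

/-- One doubling step of `replicate`. -/
def double (N t m : ℕ) : ℕ := Nat.lor m (Nat.shiftLeft m (Nat.mul t N))

/-- `M` copies of the block `m` of length `N`, where `64 ≤ M ≤ 128`. -/
def replicate (M N m : ℕ) : ℕ :=
  double N (Nat.sub M 64) (double N 32 (double N 16 (double N 8 (double N 4 (double N 2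
    (double N 1 m))))))

/-- Perform the moves on all blocks. -/
noncomputable def blockMoves (M N : ℕ) (l : List (ℕ × ℕ)) : List (ℕ × ℕ) :=
  List.rec [] (fun p _ ih => (p.1, replicate M N p.2) :: ih) l

/-- An upper bound for the number of binary digits of `L`. -/
noncomputable def width (h L : ℕ) : ℕ :=
  Nat.rec (fun L acc => Nat.add acc L)
    (fun h ih L acc =>
      let K := Nat.shiftRight L (Nat.pow 2 h)
      cond (Nat.beq K 0) (ih L acc) (ih K (Nat.add acc (Nat.pow 2 h)))) h L 0

/-- A batch of `N` lanes; `L` is the set of lanes that are still alive. -/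
structure Batch where
  N : ℕ
  L : ℕ
  A : ℕ
  B : ℕ

/-- Color the positions that are forced by progressions, and drop the contradictory lanes. -/
noncomputable def propagate (M h : ℕ) (ws : List (ℕ × ℕ)) (s : Batch) : Batch :=
  let V := validMask M h ws s.N
  let B := Nat.lor s.B (Nat.land V (unionUpTo (Nat.mul 5 s.N) (sixRule s.N s.A) (Nat.div M 5)))
  let A := Nat.lor s.A (Nat.land V (unionUpTo (Nat.mul 3 s.N) (fourRule s.N B) (Nat.div M 3)))
  ⟨s.N, removeBits s.L (foldBlocks s.N (Nat.land A B)), A, B⟩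

/-- The block of `A` that belongs to position `x`. -/
def block (N x A : ℕ) : ℕ :=
  Nat.shiftRight (Nat.shiftLeft (Nat.land A (Nat.shiftLeft (ones N) (Nat.mul x N)))
    (Nat.mul (Nat.sub 127 x) N)) (Nat.mul 127 N)

/-- The moves that gather the lanes of `m`. -/
noncomputable def laneMoves (N m : ℕ) : List (ℕ × ℕ) :=
  let h := width 4 N
  squeezePlan h h 1 m (Nat.shiftLeft (Nat.xor (ones N) m) 1)

/-- Restrict `A` to the lanes of `m`, gather them, and change the block length to `N'`. -/
noncomputable def gather (M N N' m : ℕ) (l : List (ℕ × ℕ)) (A : ℕ) : ℕ :=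
  restride N N' (applyMoves (blockMoves M N l) (Nat.land A (replicate M N m)))

/-- Split every lane according to the color of the position `x`. -/
noncomputable def branch (M x : ℕ) (s : Batch) (k : Batch → Bool) : Bool :=
  let m₀ := removeBits s.L (block s.N x s.B)
  let m₁ := removeBits s.L (block s.N x s.A)
  let p₀ := laneMoves s.N m₀
  let p₁ := laneMoves s.N m₁
  cond (cond (movesOk p₀ m₀) (movesOk p₁ m₁) false)
    (let L₀ := applyMoves p₀ m₀
     let L₁ := applyMoves p₁ m₁
     let n₀ := width 16 L₀
     let n₁ := width 16 L₁
     let N' := Nat.add n₀ n₁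
     k ⟨N', Nat.lor L₀ (Nat.shiftLeft L₁ n₀),
      Nat.lor (Nat.lor (gather M s.N N' m₀ p₀ s.A)
        (Nat.shiftLeft (gather M s.N N' m₁ p₁ s.A) n₀)) (Nat.shiftLeft L₀ (Nat.mul x N')),
      Nat.lor (Nat.lor (gather M s.N N' m₀ p₀ s.B)
        (Nat.shiftLeft (gather M s.N N' m₁ p₁ s.B) n₀))
        (Nat.shiftLeft L₁ (Nat.add n₀ (Nat.mul x N')))⟩)
    false

/-- A search plan: branch on the color of a position, or continue separately with the first `j`
windows and with the other windows. -/
inductive Plan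
  | done
  | step (x : ℕ) (p : Plan)
  | split (j : ℕ) (p q : Plan)

/-- Branch on the positions of the list `l`, then continue with the plan `p`. -/
noncomputable def steps (l : List ℕ) (p : Plan) : Plan := List.rec p (fun x _ ih => .step x ih) l

/-- Run a plan; the result is `true` if no lane survives. -/
noncomputable def refute (M h : ℕ) (p : Plan) : List (ℕ × ℕ) → Batch → Bool :=
  Plan.rec (fun _ s => Nat.beq s.L 0)
    (fun x _ ih ws s =>
      cond (cond (Nat.ble (lower ws) x)
          (cond (Nat.ble (Nat.succ x) (upper M ws)) (cond (Nat.beq x h) false true) false) false)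
        (branch M x (propagate M h ws s) (ih ws)) false)
    (fun j _ _ ih ih' ws s => cond (ih (ws.take j) s) (ih' (ws.drop j) s) false) p

/-- The number whose bits are the elements of `l`. -/
noncomputable def bits (l : List ℕ) : ℕ :=
  List.rec 0 (fun x _ ih => Nat.lor (Nat.shiftLeft 1 x) ih) l

/-- The plan `p` refutes all colorings with color `0` on `as` and color `1` on `bs`. -/
noncomputable def check (M h : ℕ) (ws : List (ℕ × ℕ)) (as bs : List ℕ) (p : Plan) : Bool :=
  cond (Nat.ble 64 M) (cond (Nat.ble M 128) (refute M h p ws ⟨1, 1, bits as, bits bs⟩) false) false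

/-! ### Correctness of the bit operations -/

lemma testBit_ones (n i : ℕ) : (ones n).testBit i = decide (i < n) := by
  change (1 <<< n - 1).testBit i = _
  rw [Nat.one_shiftLeft, Nat.testBit_two_pow_sub_one]

lemma testBit_removeBits (a b i : ℕ) :
    (removeBits a b).testBit i = (a.testBit i && !b.testBit i) := by
  change (a ^^^ (a &&& b)).testBit i = _
  rw [Nat.testBit_xor, Nat.testBit_and]
  cases a.testBit i <;> cases b.testBit i <;> rfl

lemma testBit_shl (a k i : ℕ) :
    (Nat.shiftLeft a k).testBit i = (decide (k ≤ i) && a.testBit (i - k)) :=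
  Nat.testBit_shiftLeft a

lemma testBit_shr (a k i : ℕ) : (Nat.shiftRight a k).testBit i = a.testBit (k + i) :=
  Nat.testBit_shiftRight a

lemma testBit_lor (a b i : ℕ) : (Nat.lor a b).testBit i = (a.testBit i || b.testBit i) :=
  Nat.testBit_or a b i

lemma testBit_land (a b i : ℕ) : (Nat.land a b).testBit i = (a.testBit i && b.testBit i) :=
  Nat.testBit_and a b i

lemma testBit_lxor (a b i : ℕ) : (Nat.xor a b).testBit i = (a.testBit i ^^ b.testBit i) :=
  Nat.testBit_xor a b i

lemma testBit_bits {l : List ℕ} {i : ℕ} : (bits l).testBit i = true ↔ i ∈ l := by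
  induction l with
  | nil => simp [bits]
  | cons x l ih =>
    change (Nat.lor (Nat.shiftLeft 1 x) (bits l)).testBit i = true ↔ _
    rw [testBit_lor, Bool.or_eq_true, ih, List.mem_cons]
    change (1 <<< x).testBit i = true ∨ _ ↔ _
    rw [Nat.one_shiftLeft, Nat.testBit_two_pow]
    simp [eq_comm]

lemma mul_add_inj {N x y i j : ℕ} (hi : i < N) (hj : j < N) (h : x * N + i = y * N + j) :
    x = y ∧ i = j := by
  have hN : 0 < N := by omega
  have h₁ : (i + N * x) / N = (j + N * y) / N := by congr 1; linarith
  rw [Nat.add_mul_div_left _ _ hN, Nat.add_mul_div_left _ _ hN, Nat.div_eq_of_lt hi,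
    Nat.div_eq_of_lt hj, zero_add, zero_add] at h₁
  subst h₁
  exact ⟨rfl, by omega⟩

/-- Every index is `x * N + i` for some block `x` and lane `i`. -/
lemma exists_block {N : ℕ} (hN : 0 < N) (j : ℕ) : ∃ x i, i < N ∧ j = x * N + i :=
  ⟨j / N, j % N, Nat.mod_lt _ hN, by rw [mul_comm]; exact (Nat.div_add_mod j N).symm⟩

lemma exists_of_sixRule {N A d k : ℕ} (h : (sixRule N A d).testBit (k + 5 * (d * N)) = true) :
    ∃ a t, t < 6 ∧ k = a + t * (d * N) ∧
      ∀ u < 6, u ≠ t → A.testBit (a + u * (d * N)) = true := by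
  simp only [sixRule, testBit_lor, testBit_land, testBit_shl, Bool.or_eq_true, Bool.and_eq_true,
    decide_eq_true_eq, Nat.mul_eq] at h
  generalize d * N = s at *
  have key : ∀ t < 6, t * s ≤ k →
      (∀ u < 6, u ≠ t → ∃ i, A.testBit i = true ∧ i = k - t * s + u * s) →
      ∃ a t, t < 6 ∧ k = a + t * s ∧ ∀ u < 6, u ≠ t → A.testBit (a + u * s) = true :=
    fun t ht hk hu => ⟨k - t * s, t, ht, by omega, fun u h₁ h₂ => by
      obtain ⟨i, h₃, rfl⟩ := hu u h₁ h₂; exact h₃⟩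
  rcases h with ⟨_, ⟨_, ⟨_, ⟨_, ⟨_, _, ⟨⟨e₁, _, e₂⟩, _, e₃, _, e₄⟩, _, e₅⟩ |
      ⟨e₁, _, ⟨e₂, _, e₃⟩, _, e₄, _, e₅⟩⟩ | ⟨⟨e₁, _, e₂⟩, _, ⟨e₃, _, e₄⟩, _, e₅⟩⟩ |
      ⟨⟨⟨e₁, _, e₂⟩, _, e₃⟩, _, e₄, _, e₅⟩⟩ | ⟨⟨⟨e₁, _, e₂⟩, _, e₃, _, e₄⟩, _, e₅⟩⟩ |
      ⟨⟨⟨e₁, _, e₂⟩, _, e₃, _, e₄⟩, _, e₅⟩ <;>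
    [refine key 5 (by omega) (by omega) ?_; refine key 4 (by omega) (by omega) ?_;
     refine key 3 (by omega) (by omega) ?_; refine key 2 (by omega) (by omega) ?_;
     refine key 1 (by omega) (by omega) ?_; refine key 0 (by omega) (by omega) ?_]
  all_goals
    intro u hu hne
    interval_cases u <;>
    first
    | omega
    | exact ⟨_, e₁, by omega⟩
    | exact ⟨_, e₂, by omega⟩
    | exact ⟨_, e₃, by omega⟩
    | exact ⟨_, e₄, by omega⟩
    | exact ⟨_, e₅, by omega⟩

lemma exists_of_fourRule {N B d k : ℕ} (h : (fourRule N B d).testBit (k + 3 * (d * N)) = true) :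
    ∃ a t, t < 4 ∧ k = a + t * (d * N) ∧
      ∀ u < 4, u ≠ t → B.testBit (a + u * (d * N)) = true := by
  simp only [fourRule, testBit_lor, testBit_land, testBit_shl, Bool.or_eq_true, Bool.and_eq_true,
    decide_eq_true_eq, Nat.mul_eq] at h
  generalize d * N = s at *
  have key : ∀ t < 4, t * s ≤ k →
      (∀ u < 4, u ≠ t → ∃ i, B.testBit i = true ∧ i = k - t * s + u * s) →
      ∃ a t, t < 4 ∧ k = a + t * s ∧ ∀ u < 4, u ≠ t → B.testBit (a + u * s) = true :=
    fun t ht hk hu => ⟨k - t * s, t, ht, by omega, fun u h₁ h₂ => by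
      obtain ⟨i, h₃, rfl⟩ := hu u h₁ h₂; exact h₃⟩
  rcases h with ⟨_, ⟨_, ⟨_, ⟨_, e₁⟩, ⟨_, e₂⟩, _, e₃⟩ | ⟨e₁, ⟨_, e₂⟩, _, e₃⟩⟩ |
      ⟨⟨e₁, _, e₂⟩, _, e₃⟩⟩ | ⟨⟨e₁, _, e₂⟩, _, e₃⟩ <;>
    [refine key 3 (by omega) (by omega) ?_; refine key 2 (by omega) (by omega) ?_;
     refine key 1 (by omega) (by omega) ?_; refine key 0 (by omega) (by omega) ?_]
  all_goals
    intro u hu hne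
    interval_cases u <;>
    first
    | omega
    | exact ⟨_, e₁, by omega⟩
    | exact ⟨_, e₂, by omega⟩
    | exact ⟨_, e₃, by omega⟩

lemma exists_of_unionUpTo {w n k : ℕ} {f : ℕ → ℕ} (h : (unionUpTo w f n).testBit k = true) :
    ∃ d, 0 < d ∧ (f d).testBit (k + d * w) = true := by
  rw [unionUpTo, testBit_shr] at h
  have key : ∀ (n j : ℕ), (Nat.rec 0 (fun d acc => Nat.lor (Nat.shiftLeft acc w) (f (Nat.succ d))) n
      : ℕ).testBit (n * w + j) = true → ∃ d, 0 < d ∧ (f d).testBit (j + d * w) = true := by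
    intro n
    induction n with
    | zero => simp
    | succ n ih =>
      intro j hj
      simp only [testBit_lor, testBit_shl, Bool.or_eq_true, Bool.and_eq_true] at hj
      rcases hj with ⟨_, hj⟩ | hj
      · exact ih j (by rwa [show (n + 1) * w + j - w = n * w + j by rw [add_mul]; omega] at hj)
      · exact ⟨n + 1, by omega, by rwa [add_comm j]⟩
  exact key n k h

lemma lower_le {ws : List (ℕ × ℕ)} {w : ℕ × ℕ} (hw : w ∈ ws) : w.1 ≤ lower ws := by
  induction ws with
  | nil => simp at hw
  | cons v ws ih =>
    change _ ≤ cond (Nat.ble v.1 (lower ws)) (lower ws) v.1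
    have := Nat.ble_eq (x := v.1) (y := lower ws)
    rcases List.mem_cons.1 hw with rfl | hw
    · cases h : Nat.ble w.1 (lower ws) <;> simp_all
    · have := ih hw
      cases h : Nat.ble v.1 (lower ws) <;> simp_all; omega

lemma upper_le {M : ℕ} {ws : List (ℕ × ℕ)} {w : ℕ × ℕ} (hw : w ∈ ws) : upper M ws ≤ w.2 := by
  induction ws with
  | nil => simp at hw
  | cons v ws ih =>
    change cond (Nat.ble (upper M ws) v.2) (upper M ws) v.2 ≤ _
    have := Nat.ble_eq (x := upper M ws) (y := v.2)
    rcases List.mem_cons.1 hw with rfl | hw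
    · cases h : Nat.ble (upper M ws) w.2 <;> simp_all
    · have := ih hw
      cases h : Nat.ble (upper M ws) v.2 <;> simp_all; omega

lemma of_testBit_validMask {M h N x i : ℕ} {ws : List (ℕ × ℕ)} (hi : i < N)
    (hx : (validMask M h ws N).testBit (x * N + i) = true) :
    lower ws ≤ x ∧ x < upper M ws ∧ x ≠ h := by
  simp only [validMask, testBit_removeBits, testBit_ones, testBit_shl, Bool.and_eq_true,
    Bool.not_eq_true', decide_eq_true_eq, decide_eq_false_iff_not, Nat.mul_eq, not_lt,
    Bool.and_eq_false_iff] at hx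
  obtain ⟨⟨h₁, h₂⟩, h₃⟩ := hx
  refine ⟨?_, ?_, ?_⟩
  · by_contra! hc
    have : (x + 1) * N ≤ lower ws * N := Nat.mul_le_mul_right _ hc
    rw [add_mul] at this; omega
  · by_contra! hc
    have : upper M ws * N ≤ x * N := Nat.mul_le_mul_right _ hc
    omega
  · rintro rfl
    omega

lemma exists_of_foldBlocks {N C i : ℕ} (hi : i < N) (h : (foldBlocks N C).testBit i = true) :
    ∃ x, C.testBit (x * N + i) = true := by
  rw [foldBlocks, testBit_shr] at h
  have key : ∀ n j : ℕ,
      (Nat.rec C (fun i C => Nat.lor C (Nat.shiftLeft C (Nat.mul (Nat.pow 2 i) N))) n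
      : ℕ).testBit j = true → ∃ t, t * N ≤ j ∧ C.testBit (j - t * N) = true := by
    intro n
    induction n with
    | zero => exact fun j hj => ⟨0, by omega, by simpa using hj⟩
    | succ n ih =>
      intro j hj
      simp only [testBit_lor, testBit_shl, Bool.or_eq_true, Bool.and_eq_true, decide_eq_true_eq]
        at hj
      rcases hj with hj | ⟨hle, hj⟩
      · exact ih j hj
      · obtain ⟨t, h₁, h₂⟩ := ih _ hj
        change 2 ^ n * N ≤ j at hle
        change t * N ≤ j - 2 ^ n * N at h₁
        change C.testBit (j - 2 ^ n * N - t * N) = true at h₂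
        exact ⟨2 ^ n + t, by rw [add_mul]; omega, by rwa [add_mul, Nat.sub_add_eq]⟩
  obtain ⟨t, h₁, h₂⟩ := key 7 _ h
  change t * N ≤ 127 * N + i at h₁
  change C.testBit (127 * N + i - t * N) = true at h₂
  have ht : t ≤ 127 := by
    by_contra! hc
    have : 128 * N ≤ t * N := Nat.mul_le_mul_right _ hc
    omega
  refine ⟨127 - t, ?_⟩
  rwa [Nat.sub_mul, show 127 * N - t * N + i = 127 * N + i - t * N from ?_]
  have : t * N ≤ 127 * N := Nat.mul_le_mul_right _ ht
  omega

lemma testBit_of_block {N x A i : ℕ} (hi : i < N) (h : (block N x A).testBit i = true) :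
    A.testBit (x * N + i) = true := by
  simp only [block, testBit_shr, testBit_shl, testBit_land, testBit_ones, Bool.and_eq_true,
    decide_eq_true_eq, Nat.mul_eq] at h
  obtain ⟨-, h₁, h₂, h₃⟩ := h
  have hx : x ≤ 127 := by
    by_contra! hc
    have : 128 * N ≤ x * N := Nat.mul_le_mul_right _ hc
    omega
  have : x * N ≤ 127 * N := Nat.mul_le_mul_right _ hx
  have h₄ : (127 - x) * N = 127 * N - x * N := Nat.sub_mul _ _ _
  change A.testBit (127 * N + i - (127 - x) * N) = true at h₁
  rwa [h₄, show 127 * N + i - (127 * N - x * N) = x * N + i by omega] at h₁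

lemma lt_two_pow_width (h L : ℕ) : L < 2 ^ width h L := by
  have key : ∀ h L acc : ℕ, ∃ w, L < 2 ^ w ∧
      (Nat.rec (fun L acc => Nat.add acc L)
        (fun h ih L acc =>
          let K := Nat.shiftRight L (Nat.pow 2 h)
          cond (Nat.beq K 0) (ih L acc) (ih K (Nat.add acc (Nat.pow 2 h)))) h : ℕ → ℕ → ℕ) L acc
        = acc + w := by
    intro h
    induction h with
    | zero => exact fun L acc => ⟨L, L.lt_two_pow_self, rfl⟩
    | succ h ih =>
      intro L acc
      dsimp only
      by_cases hK : Nat.shiftRight L (Nat.pow 2 h) = 0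
      · rw [hK]
        exact ih L acc
      · obtain ⟨w, h₁, h₂⟩ := ih (Nat.shiftRight L (Nat.pow 2 h)) (acc + 2 ^ h)
        refine ⟨2 ^ h + w, ?_, ?_⟩
        · change L >>> (2 ^ h) < 2 ^ w at h₁
          rw [Nat.shiftRight_eq_div_pow, Nat.div_lt_iff_lt_mul (by positivity)] at h₁
          rwa [add_comm, pow_add]
        · have : Nat.beq (Nat.shiftRight L (Nat.pow 2 h)) 0 = false := by
            rw [Bool.eq_false_iff, ne_eq, Nat.beq_eq]; exact hK
          rw [this, ← add_assoc]
          exact h₂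
  obtain ⟨w, h₁, h₂⟩ := key h L 0
  rw [zero_add] at h₂
  rw [width, h₂]
  exact h₁

lemma lt_width {h L i : ℕ} (hi : L.testBit i = true) : i < width h L := by
  by_contra! hc
  rw [Nat.testBit_lt_two_pow
    ((lt_two_pow_width h L).trans_le (Nat.pow_le_pow_right (by norm_num) hc))] at hi
  exact Bool.false_ne_true hi

lemma testBit_double {N t c m m' : ℕ} (htc : t ≤ c)
    (hm : ∀ x i, i < N → (m'.testBit (x * N + i) = true ↔ x < c ∧ m.testBit i = true)) :
    ∀ x i, i < N →
      ((double N t m').testBit (x * N + i) = true ↔ x < c + t ∧ m.testBit i = true) := by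
  intro x i hi
  rw [double, testBit_lor, testBit_shl, Bool.or_eq_true, Bool.and_eq_true, decide_eq_true_eq,
    hm x i hi]
  change _ ∨ t * N ≤ x * N + i ∧ m'.testBit (x * N + i - t * N) = true ↔ _
  rcases le_or_gt t x with htx | htx
  · have h₁ : t * N ≤ x * N := Nat.mul_le_mul_right _ htx
    rw [show x * N + i - t * N = (x - t) * N + i by rw [Nat.sub_mul]; omega, hm _ i hi]
    grind
  · have h₁ : (x + 1) * N ≤ t * N := Nat.mul_le_mul_right _ htx
    have h₂ : ¬ t * N ≤ x * N + i := by rw [add_mul] at h₁; omega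
    grind

lemma testBit_replicate {M N m : ℕ} (hM : 64 ≤ M ∧ M ≤ 128) (hm : ∀ i, m.testBit i = true → i < N)
    (x i : ℕ) (hi : i < N) :
    (replicate M N m).testBit (x * N + i) = true ↔ x < M ∧ m.testBit i = true := by
  have h₀ : ∀ x i, i < N → (m.testBit (x * N + i) = true ↔ x < 1 ∧ m.testBit i = true) := by
    intro x i hi
    rcases Nat.eq_zero_or_pos x with rfl | hx
    · simp
    · have : N ≤ x * N := Nat.le_mul_of_pos_left _ hx
      have := mt (hm (x * N + i)) (by omega)
      simp only [Bool.not_eq_true] at this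
      simp [this]; omega
  have h := testBit_double (t := M - 64) (by omega) <| testBit_double (t := 32) (by omega) <|
    testBit_double (t := 16) (by omega) <| testBit_double (t := 8) (by omega) <|
    testBit_double (t := 4) (by omega) <| testBit_double (t := 2) (by omega) <|
    testBit_double (t := 1) le_rfl h₀
  have := h x i hi
  rwa [show 1 + 1 + 2 + 4 + 8 + 16 + 32 + (M - 64) = M by omega] at this

/-- All bits of `A` lie in the first `M` blocks and in the lanes of `m`. -/
def Fits (M N m A : ℕ) : Prop :=
  ∀ x i, i < N → A.testBit (x * N + i) = true → x < M ∧ m.testBit i = true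

lemma movesOk_cons {k mv m : ℕ} {l : List (ℕ × ℕ)} (h : movesOk ((k, mv) :: l) m = true) :
    (∀ i, mv.testBit i = true → k ≤ i) ∧ (∀ i, mv.testBit i = true → m.testBit i = true) ∧
      (∀ i, mv.testBit (k + i) = true → m.testBit i = true → mv.testBit i = true) ∧
        movesOk l (moveBits k mv m) = true := by
  change cond (Nat.beq (Nat.shiftLeft (Nat.shiftRight mv k) k) mv)
      (cond (Nat.beq (removeBits mv m) 0)
        (cond (Nat.beq (Nat.land (Nat.shiftRight mv k) (removeBits m mv)) 0)
          (movesOk l (moveBits k mv m)) false) false) false = true at h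
  simp only [Bool.cond_false_right, Bool.and_eq_true, Nat.beq_eq] at h
  obtain ⟨h₁, h₂, h₃, h₄⟩ := h
  refine ⟨fun i hi => ?_, fun i hi => ?_, fun i h₅ h₆ => ?_, h₄⟩
  · rw [← h₁, testBit_shl] at hi
    simp_all
  · have := congrArg (Nat.testBit · i) h₂
    simp only [testBit_removeBits, hi, Nat.zero_testBit] at this
    simpa using this
  · have := congrArg (Nat.testBit · i) h₃
    simp only [testBit_land, testBit_shr, testBit_removeBits, Nat.zero_testBit, h₅, h₆] at this
    simpa using this

lemma testBit_moveBits (k mv b i : ℕ) : (moveBits k mv b).testBit i =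
    ((b.testBit i && !mv.testBit i) || (b.testBit (k + i) && mv.testBit (k + i))) := by
  simp only [moveBits, testBit_lor, testBit_lxor, testBit_shr, testBit_land]
  cases b.testBit i <;> cases mv.testBit i <;> simp

lemma testBit_blockMove {M N k mv m : ℕ} (hM : 64 ≤ M ∧ M ≤ 128)
    (hm : ∀ i, m.testBit i = true → i < N) (h₁ : ∀ i, mv.testBit i = true → k ≤ i)
    (h₂ : ∀ i, mv.testBit i = true → m.testBit i = true)
    {A x i : ℕ} (hA : Fits M N m A) (hi : i < N) :
    (moveBits k (replicate M N mv) A).testBit (x * N + i) =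
      ((A.testBit (x * N + i) && !mv.testBit i) ||
        (A.testBit (x * N + (k + i)) && mv.testBit (k + i))) := by
  have hmv : ∀ i, mv.testBit i = true → i < N := fun i hi => hm i (h₂ i hi)
  have hrep := fun x i hi => testBit_replicate (M := M) hM hmv x i hi
  rw [testBit_moveBits]
  congr 1
  · cases hb : A.testBit (x * N + i)
    · simp
    · have h₃ := hrep x i hi
      have h₄ := (hA x i hi hb).1
      simp only [h₄, true_and] at h₃
      rw [Bool.eq_iff_iff.2 h₃]
  · rw [show k + (x * N + i) = x * N + (k + i) by ring]
    rcases lt_or_ge (k + i) N with hki | hki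
    · cases hb : A.testBit (x * N + (k + i))
      · simp
      · have h₃ := hrep x _ hki
        have h₄ := (hA x _ hki hb).1
        simp only [h₄, true_and] at h₃
        rw [Bool.eq_iff_iff.2 h₃]
    · have h₃ : mv.testBit (k + i) = false := by
        by_contra h; exact absurd (hmv _ (by simpa using h)) (by omega)
      have h₄ : (replicate M N mv).testBit (x * N + (k + i)) = false := by
        obtain ⟨y, j, hj, hyj⟩ := exists_block (show 0 < N by omega) (x * N + (k + i))
        rw [hyj]
        by_contra h
        have h₅ := h₁ j (((hrep y j hj).1 (by simpa using h)).2)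
        have hxy : x < y := by
          by_contra! hc
          have : y * N ≤ x * N := Nat.mul_le_mul_right _ hc
          omega
        have : (x + 1) * N ≤ y * N := Nat.mul_le_mul_right _ hxy
        rw [add_mul] at this
        omega
      rw [h₃, h₄]

/-- The moves transport the lanes of `m`, without mixing them. -/
lemma exists_of_applyMoves {M N : ℕ} (hM : 64 ≤ M ∧ M ≤ 128) (l : List (ℕ × ℕ)) (m : ℕ)
    (hm : ∀ i, m.testBit i = true → i < N) (hl : movesOk l m = true) :
    (∀ i, (applyMoves l m).testBit i = true → i < N) ∧
    (∀ A, Fits M N m A → Fits M N (applyMoves l m) (applyMoves (blockMoves M N l) A)) ∧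
    ∀ i, m.testBit i = true → ∃ i', (applyMoves l m).testBit i' = true ∧
      ∀ A, Fits M N m A → ∀ x,
        (applyMoves (blockMoves M N l) A).testBit (x * N + i') = true →
          A.testBit (x * N + i) = true := by
  induction l generalizing m with
  | nil => exact ⟨hm, fun A hA => hA, fun i hi => ⟨i, hi, fun A _ x h => h⟩⟩
  | cons p l ih =>
    obtain ⟨k, mv⟩ := p
    obtain ⟨h₁, h₂, h₃, h₄⟩ := movesOk_cons hl
    have hm' : ∀ i, (moveBits k mv m).testBit i = true → i < N := by
      intro i hi
      rw [testBit_moveBits] at hi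
      simp only [Bool.or_eq_true, Bool.and_eq_true] at hi
      rcases hi with hi | hi
      · exact hm i hi.1
      · have := hm _ hi.1; omega
    have hfit : ∀ A, Fits M N m A →
        Fits M N (moveBits k mv m) (moveBits k (replicate M N mv) A) := by
      intro A hA x i hi hb
      rw [testBit_blockMove hM hm h₁ h₂ hA hi] at hb
      rw [testBit_moveBits]
      simp only [Bool.or_eq_true, Bool.and_eq_true] at hb ⊢
      rcases hb with hb | hb
      · have := hA x i hi hb.1
        exact ⟨this.1, .inl ⟨this.2, hb.2⟩⟩
      · have := hA x (k + i) (hm _ (h₂ _ hb.2)) hb.1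
        exact ⟨this.1, .inr ⟨this.2, hb.2⟩⟩
    obtain ⟨i₁, i₂, i₃⟩ := ih _ hm' h₄
    refine ⟨i₁, fun A hA => i₂ _ (hfit A hA), fun i hi => ?_⟩
    have key : ∃ j, (moveBits k mv m).testBit j = true ∧ ∀ A, Fits M N m A → ∀ x,
        (moveBits k (replicate M N mv) A).testBit (x * N + j) = true →
          A.testBit (x * N + i) = true := by
      cases hmi : mv.testBit i
      · refine ⟨i, by simp [testBit_moveBits, hi, hmi], fun A hA x hb => ?_⟩
        rw [testBit_blockMove hM hm h₁ h₂ hA (hm i hi)] at hb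
        simp only [Bool.or_eq_true, Bool.and_eq_true] at hb
        rcases hb with hb | hb
        · exact hb.1
        · simp [h₃ i hb.2 hi] at hmi
      · have hki := h₁ i hmi
        have hki' : k + (i - k) = i := by omega
        refine ⟨i - k, by simp [testBit_moveBits, hki', hi, hmi], fun A hA x hb => ?_⟩
        have hik : i - k < N := by have := hm i hi; omega
        rw [testBit_blockMove hM hm h₁ h₂ hA hik, hki'] at hb
        simp only [Bool.or_eq_true, Bool.and_eq_true, Bool.not_eq_true'] at hb
        rcases hb with hb | hb
        · have h₅ := h₃ (i - k) (by rwa [hki']) (hA x _ hik hb.1).2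
          simp [h₅] at hb
        · exact hb.1
    obtain ⟨j, hj, hj'⟩ := key
    obtain ⟨i', hi', hi''⟩ := i₃ j hj
    exact ⟨i', hi', fun A hA x hb => hj' A hA x (hi'' _ (hfit A hA) x hb)⟩

lemma exists_of_stripes {w G h J : ℕ} (hJ : (stripes w G h).testBit J = true) :
    ∃ q u, q < 2 ^ h ∧ u < w ∧ J = q * G + u := by
  induction h generalizing J with
  | zero =>
    change (ones w).testBit J = true at hJ
    rw [testBit_ones, decide_eq_true_eq] at hJ
    exact ⟨0, J, by simp, hJ, by simp⟩
  | succ h ih =>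
    change (Nat.lor (stripes w G h) (Nat.shiftLeft (stripes w G h) (2 ^ h * G))).testBit J
      = true at hJ
    rw [testBit_lor, testBit_shl, Bool.or_eq_true, Bool.and_eq_true, decide_eq_true_eq] at hJ
    rcases hJ with hJ | ⟨hle, hJ⟩
    · obtain ⟨q, u, hq, hu, rfl⟩ := ih hJ
      exact ⟨q, u, by rw [pow_succ]; omega, hu, rfl⟩
    · obtain ⟨q, u, hq, hu, hJ'⟩ := ih hJ
      exact ⟨2 ^ h + q, u, by rw [pow_succ]; omega, hu, by rw [add_mul]; omega⟩

lemma exists_of_restrideStep {N N' j A J : ℕ}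
    (h : (restrideStep N N' (min N N') (max N N') j A).testBit J = true) :
    ∃ Q c u, Q < 2 ^ (6 - j) ∧ c < 2 ∧ u < 2 ^ j * min N N' ∧
      J = Q * (2 * (2 ^ j * max N N')) + (c * (2 ^ j * N') + u) ∧
      A.testBit (Q * (2 * (2 ^ j * max N N')) + (c * (2 ^ j * N) + u)) = true := by
  have hE := fun J => exists_of_stripes (w := 2 ^ j * min N N') (G := 2 * 2 ^ j * max N N')
    (h := 6 - j) (J := J)
  change (Nat.lor (Nat.land A (stripes (2 ^ j * min N N') (2 * 2 ^ j * max N N') (6 - j)))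
    (cond (Nat.ble N' N) (Nat.shiftRight (Nat.land A (Nat.shiftLeft
      (stripes (2 ^ j * min N N') (2 * 2 ^ j * max N N') (6 - j)) (2 ^ j * N))) (2 ^ j * (N - N')))
      (Nat.shiftLeft (Nat.land A (Nat.shiftLeft (stripes (2 ^ j * min N N') (2 * 2 ^ j * max N N')
        (6 - j)) (2 ^ j * N))) (2 ^ j * (N' - N))))).testBit J = true at h
  rw [testBit_lor, Bool.or_eq_true, testBit_land, Bool.and_eq_true] at h
  rcases h with h | h
  · obtain ⟨Q, u, hQ, hu, rfl⟩ := hE _ h.2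
    exact ⟨Q, 0, u, hQ, by omega, hu, by ring, by
      rw [← h.1]; congr 1; ring⟩
  · rcases le_or_gt N' N with hN | hN
    · rw [Nat.ble_eq_true_of_le hN, cond_true, testBit_shr, testBit_land, testBit_shl,
        Bool.and_eq_true, Bool.and_eq_true, decide_eq_true_eq] at h
      obtain ⟨h₁, h₂, h₃⟩ := h
      obtain ⟨Q, u, hQ, hu, hJ⟩ := hE _ h₃
      have h₄ : 2 ^ j * (N - N') + 2 ^ j * N' = 2 ^ j * N := by rw [← mul_add]; congr 1; omega
      have h₅ : 2 * 2 ^ j * max N N' = 2 * (2 ^ j * max N N') := by ring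
      rw [h₅] at hJ
      refine ⟨Q, 1, u, hQ, by omega, hu, by omega, ?_⟩
      rw [← h₁]; congr 1; omega
    · have hb : Nat.ble N' N = false := by
        rw [Bool.eq_false_iff, ne_eq, Nat.ble_eq]; omega
      rw [hb, cond_false, testBit_shl, testBit_land, testBit_shl,
        Bool.and_eq_true, Bool.and_eq_true, Bool.and_eq_true, decide_eq_true_eq,
        decide_eq_true_eq] at h
      obtain ⟨h₀, h₁, h₂, h₃⟩ := h
      obtain ⟨Q, u, hQ, hu, hJ⟩ := hE _ h₃
      have h₄ : 2 ^ j * (N' - N) + 2 ^ j * N = 2 ^ j * N' := by rw [← mul_add]; congr 1; omega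
      have h₅ : 2 * 2 ^ j * max N N' = 2 * (2 ^ j * max N N') := by ring
      rw [h₅] at hJ
      refine ⟨Q, 1, u, hQ, by omega, hu, by omega, ?_⟩
      rw [← h₁]; congr 1; omega

/-- A bit of the result of `restrideStep` comes from the corresponding bit of the argument. -/
lemma testBit_of_restrideStep {N N' j A Q r i : ℕ} {a : ℕ} (ha : a = min N N') (hi : i < a)
    (hr : r < 2 * 2 ^ j)
    (h : (restrideStep N N' a (max N N') j A).testBit
      (Q * (2 * (2 ^ j * max N N')) + (r / 2 ^ j * (2 ^ j * N') + (r % 2 ^ j * a + i))) = true) :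
    A.testBit (Q * (2 * (2 ^ j * max N N')) + (r / 2 ^ j * (2 ^ j * N) + (r % 2 ^ j * a + i)))
      = true := by
  subst ha
  obtain ⟨Q', c', u', -, hc', hu', hJ, hA⟩ := exists_of_restrideStep h
  have hp : 0 < 2 ^ j := by positivity
  have hc : r / 2 ^ j < 2 := by rw [Nat.div_lt_iff_lt_mul hp]; exact hr
  have hu : r % 2 ^ j * min N N' + i < 2 ^ j * min N N' := by
    have : (r % 2 ^ j + 1) * min N N' ≤ 2 ^ j * min N N' :=
      Nat.mul_le_mul_right _ (Nat.mod_lt _ hp)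
    rw [add_mul] at this; omega
  have h₁ : 2 ^ j * min N N' ≤ 2 ^ j * N' := Nat.mul_le_mul_left _ (min_le_right _ _)
  have h₂ : 2 ^ j * N' ≤ 2 ^ j * max N N' := Nat.mul_le_mul_left _ (le_max_right _ _)
  have bound : ∀ c u, c < 2 → u < 2 ^ j * min N N' →
      c * (2 ^ j * N') + u < 2 * (2 ^ j * max N N') := by
    intro c u hc hu
    have : c * (2 ^ j * N') ≤ 1 * (2 ^ j * N') := Nat.mul_le_mul_right _ (by omega)
    omega
  obtain ⟨rfl, h₃⟩ := mul_add_inj (bound _ _ hc hu) (bound _ _ hc' hu') hJ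
  obtain ⟨rfl, rfl⟩ := mul_add_inj (hu.trans_le h₁) (hu'.trans_le h₁) h₃
  exact hA

/-- A bit of the result of `restride` comes from the corresponding bit of the argument. -/
lemma testBit_of_restride {N N' A x i : ℕ} (hi : i < N')
    (h : (restride N N' A).testBit (x * N' + i) = true) :
    i < N ∧ A.testBit (x * N + i) = true := by
  rw [restride] at h
  rcases le_or_gt N' N with hN | hN
  · rw [Nat.ble_eq_true_of_le hN, cond_true] at h
    have hmin : min N N' = N' := min_eq_right hN
    have hmax : max N N' = N := max_eq_left hN
    have key : ∀ j Q r, r < 2 ^ j →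
        (Nat.rec A (fun j acc => restrideStep N N' N' N j acc) j : ℕ).testBit
          (Q * (2 ^ j * N) + (r * N' + i)) = true →
        A.testBit ((Q * 2 ^ j + r) * N + i) = true := by
      intro j
      induction j with
      | zero =>
        intro Q r hr h
        obtain rfl : r = 0 := by simpa using hr
        simpa using h
      | succ j ih =>
        intro Q r hr h
        dsimp only at h
        have hr' := Nat.div_add_mod r (2 ^ j)
        have hh := testBit_of_restrideStep (N := N) (N' := N') (Q := Q) (r := r) hmin.symm hi
          (by rwa [pow_succ, mul_comm] at hr) (by
            rw [hmax, ← h]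
            congr 1
            nth_rw 3 [← hr']
            ring)
        rw [hmax, show Q * (2 * (2 ^ j * N)) + (r / 2 ^ j * (2 ^ j * N) + (r % 2 ^ j * N' + i)) =
          (2 * Q + r / 2 ^ j) * (2 ^ j * N) + (r % 2 ^ j * N' + i) by ring] at hh
        rw [← ih _ _ (Nat.mod_lt _ (by positivity)) hh]
        congr 1
        nth_rw 1 [← hr']
        ring
    obtain ⟨Q, c, u, hQ, hc, hu, hJ, -⟩ := exists_of_restrideStep (N := N) (N' := N') (j := 6)
      (A := Nat.rec A (fun j acc => restrideStep N N' N' N j acc) 6) (J := x * N' + i) (by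
        rw [hmin, hmax]; exact h)
    have hx : x < 2 ^ 7 := by
      by_contra! hc'
      have h₁ : 2 ^ 7 * N' ≤ x * N' := Nat.mul_le_mul_right _ hc'
      have h₂ : c * (2 ^ 6 * N') ≤ 1 * (2 ^ 6 * N') := Nat.mul_le_mul_right _ (by omega)
      obtain rfl : Q = 0 := by simpa using hQ
      rw [hmin] at hu
      omega
    have := key 7 0 x hx (by simpa using h)
    exact ⟨by omega, by simpa using this⟩
  · have hb : Nat.ble N' N = false := by
      rw [Bool.eq_false_iff, ne_eq, Nat.ble_eq]; omega
    rw [hb, cond_false] at h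
    have hmin : min N N' = N := min_eq_left hN.le
    have hmax : max N N' = N' := max_eq_right hN.le
    have key : ∀ n A Q r, r < 2 ^ n → i < N →
        ((Nat.rec (fun A => A) (fun j ih A => ih (restrideStep N N' N N' j A)) n : ℕ → ℕ)
          A).testBit ((Q * 2 ^ n + r) * N' + i) = true →
        A.testBit (Q * (2 ^ n * N') + (r * N + i)) = true := by
      intro n
      induction n with
      | zero =>
        intro A Q r hr hi h
        obtain rfl : r = 0 := by simpa using hr
        simpa using h
      | succ j ih =>
        intro A Q r hr hi h
        dsimp only at h
        have hr' := Nat.div_add_mod r (2 ^ j)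
        have hh := ih _ (2 * Q + r / 2 ^ j) (r % 2 ^ j) (Nat.mod_lt _ (by positivity)) hi (by
          rw [← h]
          congr 1
          nth_rw 3 [← hr']
          ring)
        have hh' := testBit_of_restrideStep (N := N) (N' := N') (Q := Q) (r := r) hmin.symm hi
          (by rwa [pow_succ, mul_comm] at hr) (by
            rw [hmax, ← hh]
            congr 1
            ring)
        rw [hmax] at hh'
        rw [← hh']
        congr 1
        nth_rw 1 [← hr']
        ring
    have last : ∀ n A, ∃ B,
        (Nat.rec (fun A => A) (fun j ih A => ih (restrideStep N N' N N' j A)) (n + 1) : ℕ → ℕ) A =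
          restrideStep N N' N N' 0 B := by
      intro n
      induction n with
      | zero => exact fun A => ⟨A, rfl⟩
      | succ n ih => exact fun A => ih _
    obtain ⟨B, hB⟩ := last 6 A
    have h' : (restrideStep N N' N N' 0 B).testBit (x * N' + i) = true := by rw [← hB]; exact h
    obtain ⟨Q, c, u, hQ, hc, hu, hJ, -⟩ := exists_of_restrideStep (N := N) (N' := N') (j := 0)
      (A := B) (J := x * N' + i) (by rw [hmin, hmax]; exact h')
    rw [hmin, pow_zero, one_mul] at hu
    rw [hmax, show Q * (2 * (2 ^ 0 * N')) + (c * (2 ^ 0 * N') + u) = (2 * Q + c) * N' + u by ring]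
      at hJ
    obtain ⟨rfl, rfl⟩ := mul_add_inj hi (hu.trans hN) hJ
    have := key 7 A 0 (2 * Q + c) (by norm_num at hQ ⊢; omega) hu (by simpa using h)
    exact ⟨hu, by simpa using this⟩

/-- A coloring of the positions other than `h` in one of the windows, `P₀` and `P₁` being the color
classes, such that `P₀` contains no `6`-term and `P₁` contains no `4`-term progression. -/
structure IsColoring (h : ℕ) (ws : List (ℕ × ℕ)) (P₀ P₁ : ℕ → Prop) : Prop where
  not_six : ∀ a d, 0 < d → ¬ ∀ t < 6, P₀ (a + t * d)
  not_four : ∀ a d, 0 < d → ¬ ∀ t < 4, P₁ (a + t * d)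
  disjoint : ∀ x, P₀ x → ¬ P₁ x
  exists_window : ∃ w ∈ ws, ∀ x, w.1 ≤ x → x < w.2 → x ≠ h → P₀ x ∨ P₁ x

/-- Some living lane of the batch is part of the coloring. -/
def Covers (P₀ P₁ : ℕ → Prop) (s : Batch) : Prop :=
  (∀ i, s.L.testBit i = true → i < s.N) ∧ ∃ i, s.L.testBit i = true ∧
    (∀ x, s.A.testBit (x * s.N + i) = true → P₀ x) ∧
    ∀ x, s.B.testBit (x * s.N + i) = true → P₁ x

section refute

variable {M h : ℕ} {ws : List (ℕ × ℕ)} {P₀ P₁ : ℕ → Prop}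

lemma IsColoring.mem_or_mem (hP : IsColoring h ws P₀ P₁) {x : ℕ} (h₁ : lower ws ≤ x)
    (h₂ : x < upper M ws) (h₃ : x ≠ h) : P₀ x ∨ P₁ x := by
  obtain ⟨w, hw, h₄⟩ := hP.exists_window
  exact h₄ x ((lower_le hw).trans h₁) (h₂.trans_le (upper_le hw)) h₃

lemma eq_mul_add_of_eq {N x i a t d : ℕ} (hi : i < N) (h : x * N + i = a + t * (d * N)) :
    ∃ b, x = b + t * d ∧ ∀ u, a + u * (d * N) = (b + u * d) * N + i := by
  obtain ⟨b, j, hj, rfl⟩ := exists_block (show 0 < N by omega) a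
  rw [show b * N + j + t * (d * N) = (b + t * d) * N + j by ring] at h
  obtain ⟨rfl, rfl⟩ := mul_add_inj hi hj h
  exact ⟨b, rfl, fun u => by ring⟩

lemma Covers.propagate (hP : IsColoring h ws P₀ P₁) {s : Batch} (hs : Covers P₀ P₁ s) :
    Covers P₀ P₁ (propagate M h ws s) := by
  obtain ⟨hL, i, hi, hA, hB⟩ := hs
  obtain ⟨N, L, A, B⟩ := s
  dsimp only at hL hi hA hB
  have hiN := hL i hi
  let B' := Nat.lor B (Nat.land (validMask M h ws N)
    (unionUpTo (Nat.mul 5 N) (sixRule N A) (Nat.div M 5)))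
  let A' := Nat.lor A (Nat.land (validMask M h ws N)
    (unionUpTo (Nat.mul 3 N) (fourRule N B') (Nat.div M 3)))
  have hB' : ∀ x, B'.testBit (x * N + i) = true → P₁ x := by
    intro x hx
    rw [testBit_lor, testBit_land, Bool.or_eq_true, Bool.and_eq_true] at hx
    rcases hx with hx | ⟨hV, hx⟩
    · exact hB x hx
    · obtain ⟨h₁, h₂, h₃⟩ := of_testBit_validMask hiN hV
      refine (hP.mem_or_mem h₁ h₂ h₃).resolve_left fun h₀ => ?_
      obtain ⟨d, hd, hx⟩ := exists_of_unionUpTo hx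
      rw [Nat.mul_eq, show d * (5 * N) = 5 * (d * N) by ring] at hx
      obtain ⟨a, t, ht, hk, ha⟩ := exists_of_sixRule hx
      obtain ⟨b, rfl, hb⟩ := eq_mul_add_of_eq hiN hk
      refine hP.not_six b d hd fun u hu => ?_
      by_cases hut : u = t
      · rwa [hut]
      · exact hA _ (by rw [← hb]; exact ha u hu hut)
  have hA' : ∀ x, A'.testBit (x * N + i) = true → P₀ x := by
    intro x hx
    rw [testBit_lor, testBit_land, Bool.or_eq_true, Bool.and_eq_true] at hx
    rcases hx with hx | ⟨hV, hx⟩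
    · exact hA x hx
    · obtain ⟨h₁, h₂, h₃⟩ := of_testBit_validMask hiN hV
      refine (hP.mem_or_mem h₁ h₂ h₃).resolve_right fun h₀ => ?_
      obtain ⟨d, hd, hx⟩ := exists_of_unionUpTo hx
      rw [Nat.mul_eq, show d * (3 * N) = 3 * (d * N) by ring] at hx
      obtain ⟨a, t, ht, hk, ha⟩ := exists_of_fourRule hx
      obtain ⟨b, rfl, hb⟩ := eq_mul_add_of_eq hiN hk
      refine hP.not_four b d hd fun u hu => ?_
      by_cases hut : u = t
      · rwa [hut]
      · exact hB' _ (by rw [← hb]; exact ha u hu hut)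
  change Covers P₀ P₁ ⟨N, removeBits L (foldBlocks N (Nat.land A' B')), A', B'⟩
  refine ⟨fun j hj => ?_, i, ?_, hA', hB'⟩
  · rw [testBit_removeBits, Bool.and_eq_true] at hj
    exact hL j hj.1
  · rw [testBit_removeBits, hi, Bool.true_and, Bool.not_eq_true', Bool.eq_false_iff]
    intro hf
    obtain ⟨x, hx⟩ := exists_of_foldBlocks hiN hf
    rw [testBit_land, Bool.and_eq_true] at hx
    exact hP.disjoint x (hA' x hx.1) (hB' x hx.2)

lemma exists_of_gather (hM : 64 ≤ M ∧ M ≤ 128) {N N' m : ℕ} {l : List (ℕ × ℕ)}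
    (hm : ∀ i, m.testBit i = true → i < N) (hl : movesOk l m = true) :
    (∀ A x i, i < N' → (gather M N N' m l A).testBit (x * N' + i) = true →
      (applyMoves l m).testBit i = true) ∧
    ∀ i, m.testBit i = true → ∃ i', (applyMoves l m).testBit i' = true ∧ ∀ A x, i' < N' →
      (gather M N N' m l A).testBit (x * N' + i') = true → A.testBit (x * N + i) = true := by
  obtain ⟨-, h₂, h₃⟩ := exists_of_applyMoves hM l m hm hl
  have hfit : ∀ A, Fits M N m (Nat.land A (replicate M N m)) := by
    intro A x i hi hx
    rw [testBit_land, Bool.and_eq_true, testBit_replicate hM hm x i hi] at hx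
    exact hx.2
  refine ⟨fun A x i hi hx => ?_, fun i hi => ?_⟩
  · obtain ⟨hiN, hx⟩ := testBit_of_restride hi hx
    exact (h₂ _ (hfit A) x i hiN hx).2
  · obtain ⟨i', hi', h₄⟩ := h₃ i hi
    refine ⟨i', hi', fun A x hiN hx => ?_⟩
    have h₅ := h₄ _ (hfit A) x (testBit_of_restride hiN hx).2
    rw [testBit_land, Bool.and_eq_true] at h₅
    exact h₅.1

lemma of_testBit_lor_shift {X Y n n' x i : ℕ}
    (h : (Nat.lor X (Nat.shiftLeft Y n)).testBit (x * (n + n') + i) = true) :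
    X.testBit (x * (n + n') + i) = true ∨ (n ≤ i ∧ Y.testBit (x * (n + n') + (i - n)) = true) ∨
      (i < n ∧ ∃ y, x = y + 1 ∧ Y.testBit (y * (n + n') + (n' + i)) = true) := by
  rw [testBit_lor, testBit_shl, Bool.or_eq_true, Bool.and_eq_true, decide_eq_true_eq] at h
  refine h.imp_right fun ⟨h₁, h₂⟩ => ?_
  rcases le_or_gt n i with hi | hi
  · exact .inl ⟨hi, by rw [← h₂]; congr 1; omega⟩
  · cases x with
    | zero => omega
    | succ y => exact .inr ⟨hi, y, rfl, by rw [← h₂]; congr 1; rw [add_mul]; omega⟩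

lemma of_testBit_shiftLeft {L N x y i : ℕ} (hL : ∀ i, L.testBit i = true → i < N) (hi : i < N)
    (h : (Nat.shiftLeft L (x * N)).testBit (y * N + i) = true) : y = x ∧ L.testBit i = true := by
  rw [testBit_shl, Bool.and_eq_true, decide_eq_true_eq] at h
  have h₁ := hL _ h.2
  obtain ⟨rfl, h₂⟩ := mul_add_inj hi h₁ (show y * N + i = x * N + (y * N + i - x * N) by omega)
  exact ⟨rfl, by rw [h₂]; exact h.2⟩

lemma Covers.branch (hM : 64 ≤ M ∧ M ≤ 128) {x : ℕ} {s : Batch} {k : Batch → Bool}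
    (hP : ∀ x, P₀ x → ¬ P₁ x) (hx : P₀ x ∨ P₁ x) (hs : Covers P₀ P₁ s)
    (hk : branch M x s k = true) : ∃ s', Covers P₀ P₁ s' ∧ k s' = true := by
  obtain ⟨hL, i, hi, hA, hB⟩ := hs
  obtain ⟨N, L, A, B⟩ := s
  dsimp only at hL hi hA hB
  have hiN := hL i hi
  simp only [Lanes.branch] at hk
  set m₀ := removeBits L (block N x B) with hm₀
  set m₁ := removeBits L (block N x A) with hm₁
  set p₀ := laneMoves N m₀
  set p₁ := laneMoves N m₁
  set L₀ := applyMoves p₀ m₀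
  set L₁ := applyMoves p₁ m₁
  set n₀ := width 16 L₀
  set n₁ := width 16 L₁
  simp only [Bool.cond_false_right, Bool.and_eq_true] at hk
  obtain ⟨⟨ok₀, ok₁⟩, hk⟩ := hk
  refine ⟨_, ?_, hk⟩
  have hm₀N : ∀ i, m₀.testBit i = true → i < N := fun i hi => hL i (by
    rw [hm₀, testBit_removeBits, Bool.and_eq_true] at hi; exact hi.1)
  have hm₁N : ∀ i, m₁.testBit i = true → i < N := fun i hi => hL i (by
    rw [hm₁, testBit_removeBits, Bool.and_eq_true] at hi; exact hi.1)
  obtain ⟨g₀, g₀'⟩ := exists_of_gather (N' := n₀ + n₁) hM hm₀N ok₀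
  obtain ⟨g₁, g₁'⟩ := exists_of_gather (N' := n₀ + n₁) hM hm₁N ok₁
  have hL₀ : ∀ i, L₀.testBit i = true → i < n₀ := fun i hi => lt_width hi
  have hL₁ : ∀ i, L₁.testBit i = true → i < n₁ := fun i hi => lt_width hi
  simp only [Nat.add_eq, Nat.mul_eq]
  refine ⟨fun j hj => ?_, ?_⟩
  · dsimp only at hj ⊢
    rw [testBit_lor, testBit_shl, Bool.or_eq_true, Bool.and_eq_true, decide_eq_true_eq] at hj
    rcases hj with hj | hj
    · have := hL₀ j hj; omega
    · have := hL₁ _ hj.2; omega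
  dsimp only
  have shift : ∀ y j, j < n₀ + n₁ →
      (Nat.shiftLeft L₁ (n₀ + x * (n₀ + n₁))).testBit (y * (n₀ + n₁) + j) = true →
        n₀ ≤ j ∧ y = x := by
    intro y j hj h
    rw [testBit_shl, Bool.and_eq_true, decide_eq_true_eq] at h
    have h₁ := hL₁ _ h.2
    obtain ⟨rfl, h₂⟩ := mul_add_inj hj (j := n₀ + (y * (n₀ + n₁) + j - (n₀ + x * (n₀ + n₁))))
      (x := y) (y := x) (by omega) (by omega)
    exact ⟨by omega, rfl⟩
  by_cases h₀ : P₀ x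
  · have hi₀ : m₀.testBit i = true := by
      rw [hm₀, testBit_removeBits, hi, Bool.true_and, Bool.not_eq_true', Bool.eq_false_iff]
      exact fun hb => hP x h₀ (hB x (testBit_of_block hiN hb))
    obtain ⟨j, hj, hj'⟩ := g₀' i hi₀
    have hjn := hL₀ j hj
    have old : ∀ C y, (Nat.lor (gather M N (n₀ + n₁) m₀ p₀ C)
        (Nat.shiftLeft (gather M N (n₀ + n₁) m₁ p₁ C) n₀)).testBit (y * (n₀ + n₁) + j) = true →
        C.testBit (y * N + i) = true := by
      intro C y hy
      rcases of_testBit_lor_shift hy with hy | ⟨hy, -⟩ | ⟨-, z, -, hz⟩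
      · exact hj' C y (by omega) hy
      · omega
      · have := hL₁ _ (g₁ C z (n₁ + j) (by omega) hz); omega
    refine ⟨j, by rw [testBit_lor, hj, Bool.true_or], fun y hy => ?_, fun y hy => ?_⟩
    · rw [testBit_lor, Bool.or_eq_true] at hy
      rcases hy with hy | hy
      · exact hA y (old A y hy)
      · obtain ⟨rfl, -⟩ := of_testBit_shiftLeft
          (fun i hi => (hL₀ i hi).trans_le (Nat.le_add_right _ n₁)) (by omega) hy
        exact h₀
    · rw [testBit_lor, Bool.or_eq_true] at hy
      rcases hy with hy | hy
      · exact hB y (old B y hy)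
      · have := (shift y j (by omega) hy).1; omega
  · have h₁ := hx.resolve_left h₀
    have hi₁ : m₁.testBit i = true := by
      rw [hm₁, testBit_removeBits, hi, Bool.true_and, Bool.not_eq_true', Bool.eq_false_iff]
      exact fun hb => h₀ (hA x (testBit_of_block hiN hb))
    obtain ⟨j, hj, hj'⟩ := g₁' i hi₁
    have hjn := hL₁ j hj
    have old : ∀ C y, (Nat.lor (gather M N (n₀ + n₁) m₀ p₀ C)
        (Nat.shiftLeft (gather M N (n₀ + n₁) m₁ p₁ C) n₀)).testBit (y * (n₀ + n₁) + (n₀ + j)) = true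
        → C.testBit (y * N + i) = true := by
      intro C y hy
      rcases of_testBit_lor_shift hy with hy | ⟨-, hy⟩ | ⟨hy, -⟩
      · have := hL₀ _ (g₀ C y (n₀ + j) (by omega) hy); omega
      · rw [Nat.add_sub_cancel_left] at hy
        exact hj' C y (by omega) hy
      · omega
    refine ⟨n₀ + j, ?_, fun y hy => ?_, fun y hy => ?_⟩
    · rw [testBit_lor, testBit_shl, Nat.add_sub_cancel_left, hj]
      simp
    · rw [testBit_lor, Bool.or_eq_true] at hy
      rcases hy with hy | hy
      · exact hA y (old A y hy)
      · have := hL₀ _ (of_testBit_shiftLeft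
          (fun i hi => (hL₀ i hi).trans_le (Nat.le_add_right _ n₁)) (by omega) hy).2
        omega
    · rw [testBit_lor, Bool.or_eq_true] at hy
      rcases hy with hy | hy
      · exact hB y (old B y hy)
      · obtain ⟨-, rfl⟩ := shift y _ (by omega) hy
        exact h₁

lemma not_covers_of_refute (hM : 64 ≤ M ∧ M ≤ 128) (p : Plan) (ws : List (ℕ × ℕ)) (s : Batch)
    (hP : IsColoring h ws P₀ P₁) (hp : refute M h p ws s = true) : ¬ Covers P₀ P₁ s := by
  induction p generalizing ws s with
  | done =>
    rintro ⟨-, i, hi, -⟩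
    have : s.L = 0 := Nat.eq_of_beq_eq_true hp
    simp [this] at hi
  | step x p ih =>
    intro hs
    change cond (cond (Nat.ble (lower ws) x)
          (cond (Nat.ble (Nat.succ x) (upper M ws)) (cond (Nat.beq x h) false true) false) false)
        (branch M x (propagate M h ws s) (refute M h p ws)) false = true at hp
    have hle := Nat.ble_eq (x := lower ws) (y := x)
    have hlt := Nat.ble_eq (x := Nat.succ x) (y := upper M ws)
    have hne := Nat.beq_eq (x := x) (y := h)
    simp only [Bool.cond_false_right, Bool.cond_false_left, Bool.and_true, Bool.and_eq_true, hle,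
      hlt, Bool.not_eq_true', Bool.eq_false_iff, ne_eq, hne] at hp
    obtain ⟨⟨h₁, h₂, h₃⟩, hp⟩ := hp
    obtain ⟨s', hs', hk⟩ := Covers.branch hM hP.disjoint (hP.mem_or_mem h₁ h₂ h₃)
      (hs.propagate hP) hp
    exact ih ws s' hP hk hs'
  | split j p q ihp ihq =>
    change cond (refute M h p (ws.take j) s) (refute M h q (ws.drop j) s) false = true at hp
    rw [Bool.cond_false_right, Bool.and_eq_true] at hp
    obtain ⟨w, hw, hwP⟩ := hP.exists_window
    rw [← List.take_append_drop j ws, List.mem_append] at hw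
    rcases hw with hw | hw
    · exact ihp _ s { hP with exists_window := ⟨w, hw, hwP⟩ } hp.1
    · exact ihq _ s { hP with exists_window := ⟨w, hw, hwP⟩ } hp.2

end refute

/-- There is no coloring with color `0` on `as` and color `1` on `bs`. -/
def Refuted (h : ℕ) (ws : List (ℕ × ℕ)) (as bs : List ℕ) : Prop :=
  ∀ P₀ P₁, IsColoring h ws P₀ P₁ → (∀ x ∈ as, P₀ x) → ¬ ∀ x ∈ bs, P₁ x

lemma Refuted.leaf {h : ℕ} {ws : List (ℕ × ℕ)} {as bs : List ℕ} (M : ℕ) (p : Plan)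
    (hp : check M h ws as bs p = true) : Refuted h ws as bs := by
  have h₁ := Nat.ble_eq (x := 64) (y := M)
  have h₂ := Nat.ble_eq (x := M) (y := 128)
  simp only [check, Bool.cond_false_right, Bool.and_eq_true, h₁, h₂] at hp
  refine fun P₀ P₁ hP h₀ h₁ => not_covers_of_refute ⟨hp.1, hp.2.1⟩ p ws _ hP hp.2.2 ⟨?_, 0, ?_⟩
  · intro i hi
    simpa [Nat.testBit_one_eq_true_iff_self_eq_zero] using hi
  · simpa [testBit_bits] using ⟨h₀, h₁⟩

lemma Refuted.branch {h : ℕ} {ws : List (ℕ × ℕ)} {as bs : List ℕ} (x : ℕ)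
    (h₀ : Refuted h ws (x :: as) bs) (h₁ : Refuted h ws as (x :: bs))
    (hx : x ≠ h ∧ ∀ w ∈ ws, w.1 ≤ x ∧ x < w.2 := by decide) : Refuted h ws as bs := by
  intro P₀ P₁ hP has hbs
  obtain ⟨w, hw, hwP⟩ := hP.exists_window
  rcases hwP x (hx.2 w hw).1 (hx.2 w hw).2 hx.1 with hx | hx
  · exact h₀ P₀ P₁ hP (by simpa using ⟨hx, has⟩) hbs
  · exact h₁ P₀ P₁ hP has (by simpa using ⟨hx, hbs⟩)

/-! ### The refutations found by the search -/

set_option maxRecDepth 100000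

lemma refuted_low : Refuted 16 [(16, 90), (6, 83), (0, 76)] [] [] :=
  .branch 45
    (.branch 44
      (.branch 46
        (.branch 43
          (.branch 47
            (.branch 36
              (.leaf 90 (steps [54, 60, 51, 49, 56, 64, 53, 41, 55, 39, 57, 50, 63, 61, 59, 37, 27,
                35, 62, 68, 38, 67] (.split 1 (steps [24, 31, 17] .done) (steps [30, 65, 23, 17]
                (.split 1 (steps [6] .done) (steps [19, 0] .done))))) (by decide +kernel))
              (.leaf 90 (steps [60, 24, 33, 39, 40, 41, 34, 37, 26, 35, 49, 62, 50, 64, 32, 58, 53,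
                65, 61, 55] (.split 1 (steps [29, 17] .done) (steps [57, 52, 6] .done)))
                (by decide +kernel)))
            (.branch 42
              (.branch 53
                (.leaf 90 (steps [35, 29, 38, 40, 33, 34, 48, 50, 39, 31, 30, 28, 24, 36, 52, 51,
                  25, 57, 60, 49, 58, 61, 62, 64] (.split 1 (steps [56, 26, 17] .done) (steps [8, 7,
                  63, 59] (.split 1 (steps [6] .done) (steps [0] .done))))) (by decide +kernel))
                (.leaf 90 (steps [29, 65, 56, 50, 49, 48, 55, 63, 52, 54, 40, 27, 39, 36, 58, 67,
                  60, 64, 37, 32, 69] (.split 1 (steps [66, 17] .done) (steps [31, 68, 25, 6]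
                  .done))) (by decide +kernel)))
              (.branch 52
                (.branch 37
                  (.leaf 90 (steps [49, 40, 54, 48, 56, 58, 36, 39, 34, 38, 60, 51, 41, 29, 53, 28,
                    31, 59, 65, 62, 27, 63, 67] (.split 1 (steps [30, 55, 17] .done) (steps [71, 32,
                    6] .done))) (by decide +kernel))
                  (.leaf 90 (steps [57, 27, 67, 17, 51, 33, 39, 40, 55, 49, 59, 48, 60, 34, 36, 28,
                    50, 38, 29, 63, 62, 64, 31] (.split 1 (steps [83, 56, 17] .done) (steps [19, 41,
                    8, 23] (.split 1 (steps [6] .done) (steps [0] .done))))) (by decide +kernel)))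
                (.leaf 90 (steps [62, 32, 72, 22, 51, 50, 58, 54, 60, 61, 56, 36, 49, 40, 55, 41,
                  63, 39, 38, 64, 65] (.split 1 (steps [66, 73, 71, 17] .done) (steps [29, 19, 13,
                  35] (.split 1 (steps [6] .done) (steps [0] .done))))) (by decide +kernel)))))
          (.branch 47
            (.branch 48
              (.branch 37
                (.leaf 90 (steps [55, 61, 52, 50, 57, 56, 42, 40, 51, 60, 59, 65, 62, 58, 38, 39,
                  28, 64, 30, 41, 31, 68, 34, 29] (.split 1 (steps [69, 66, 17] .done) (steps [21,
                  69, 15, 53] (.split 1 (steps [6] .done) (steps [0] .done))))) (by decide +kernel))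
                (.leaf 90 (steps [61, 25, 34, 40, 41, 42, 35, 38, 27, 36, 50, 63, 51, 65, 53, 54,
                  59, 62, 68] (.split 1 (steps [69, 33, 17] .done) (steps [56, 21, 6] .done)))
                  (by decide +kernel)))
              (.branch 38
                (.branch 53
                  (.leaf 90 (steps [50, 41, 55, 49, 57, 59, 37, 40, 35, 39, 61, 52, 42, 30, 31, 56,
                    29, 54, 62, 27, 63, 58, 69] (.split 1 (steps [19, 17] .done) (steps [51, 6]
                    .done))) (by decide +kernel))
                  (.leaf 90 (steps [63, 33, 73, 23, 51, 52, 59, 55, 61, 62, 57, 56, 50, 37, 41, 42,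
                    40, 31, 66, 64, 29, 39, 27] (.split 1 (steps [78, 75, 17] .done) (steps [30, 68,
                    6] .done))) (by decide +kernel)))
                (.leaf 90 (steps [58, 28, 68, 18, 42, 36, 60, 54, 52, 34, 50, 40, 56, 49, 55, 39,
                  62, 32, 31, 26, 41, 64, 35, 61] (.split 1 (steps [23, 57, 17] .done) (steps [29,
                  37, 24, 21] (.split 1 (steps [6] .done) (steps [0] .done)))))
                  (by decide +kernel))))
            (.branch 39
              (.branch 51
                (.leaf 90 (steps [42, 48, 38, 40, 37, 57, 54, 50, 56, 58, 30, 36, 32, 49, 33, 35,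
                  41, 61, 60, 59, 72] (.split 1 (steps [68, 17, 53, 17] .done) (steps [68, 28, 10,
                  6] .done))) (by decide +kernel))
                (.leaf 90 (steps [59, 35, 53, 27, 49, 52, 61, 57, 54, 50, 60, 56, 42, 38, 36, 62,
                  34, 48, 37, 25, 28] (.split 1 (steps [63, 65, 74, 58, 17] .done) (steps [40, 19,
                  22, 24] (.split 1 (steps [6] .done) (steps [0] .done))))) (by decide +kernel)))
              (.leaf 90 (steps [55, 31, 37, 38, 29, 36, 33, 40, 41, 30, 48, 52, 34, 54, 56, 28, 50,
                62, 53, 64, 24, 49] (.split 1 (steps [72, 42, 17] .done) (steps [12, 58, 6] .done)))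
                (by decide +kernel)))))
        (.branch 43
          (.branch 47
            (.branch 42
              (.branch 41
                (.leaf 90 (steps [52, 49, 39, 34, 58, 37, 53, 50, 61, 27, 60, 51, 35, 59, 62, 48,
                  57, 36, 64, 66, 63] (.split 1 (steps [75, 31, 33, 17] .done) (steps [23, 19, 55,
                  6] (.split 1 (steps [6] .done) (steps [0] .done))))) (by decide +kernel))
                (.leaf 90 (steps [51, 36, 31, 56, 39, 35, 32, 33, 57, 49, 59, 55, 37, 48, 40, 50,
                  63, 54, 52, 61, 64] (.split 1 (steps [67, 19, 69, 29, 60, 17] .done) (steps [26,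
                  66, 20, 29] (.split 1 (steps [27, 6] .done) (steps [60, 0] .done)))))
                  (by decide +kernel)))
              (.leaf 90 (steps [50, 54, 38, 34, 41, 39, 36, 32, 56, 49, 52, 60, 28, 51, 55, 40, 64,
                29, 61, 57, 63, 53] (.split 1 (steps [65, 59, 66, 33, 17] .done) (steps [72, 23, 31,
                8] (.split 1 (steps [67, 6] .done) (steps [48, 0] .done))))) (by decide +kernel)))
            (.branch 48
              (.leaf 90 (steps [51, 56, 36, 41, 53, 40, 52, 42, 54, 38, 60, 58, 55, 28, 37, 49, 59,
                35, 62, 63, 31, 50, 33, 27, 32] (.split 1 (steps [21, 77, 75, 17] .done) (steps [25,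
                66, 70, 30] (.split 1 (steps [6] .done) (steps [0] .done))))) (by decide +kernel))
              (.leaf 90 (steps [50, 52, 42, 34, 41, 36, 58, 56, 54, 53, 60, 38, 32, 39, 28, 37, 55,
                59, 61, 33, 27, 24] (.split 1 (steps [25, 74, 68, 18, 17] .done) (steps [25, 74, 13,
                17] (.split 1 (steps [6] .done) (steps [0] .done))))) (by decide +kernel))))
          (.branch 49
            (.branch 40
              (.leaf 90 (steps [47, 39, 53, 51, 35, 41, 57, 50, 48, 54, 33, 55, 32, 36, 59, 61, 30,
                56, 37, 42, 65, 64] (.split 1 (steps [31, 70, 18, 58, 17] .done) (steps [63, 29, 62,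
                23] (.split 1 (steps [6] .done) (steps [0] .done))))) (by decide +kernel))
              (.leaf 90 (steps [52, 34, 58, 28, 42, 38, 48, 41, 36, 33, 53, 47, 51, 32, 30, 60, 56,
                54, 59, 29, 27, 57, 24, 26, 55] (.split 1 (steps [73, 17] .done) (steps [39, 6]
                .done))) (by decide +kernel)))
            (.leaf 90 (steps [55, 47, 37, 31, 39, 36, 29, 53, 56, 38, 42, 30, 57, 33, 59, 51, 60,
              32, 62, 63, 68] (.split 1 (steps [50, 28, 17] .done) (steps [64, 35, 73] (.split 1
              (steps [58, 6] .done) (steps [67, 74, 0] .done))))) (by decide +kernel)))))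
      (.branch 46
        (.branch 43
          (.branch 47
            (.branch 42
              (.leaf 90 (steps [48, 40, 52, 36, 49, 39, 51, 37, 34, 54, 38, 30, 58, 62, 35, 61, 63,
                56, 57, 66, 55, 26] (.split 1 (steps [64, 69, 32, 17] .done) (steps [19, 53, 22, 18]
                (.split 1 (steps [59, 6] .done) (steps [59, 70, 0] .done))))) (by decide +kernel))
              (.leaf 90 (steps [40, 48, 38, 56, 49, 39, 34, 41, 54, 51, 31, 33, 35, 53, 29, 30, 55,
                61, 59, 57, 52, 62, 66, 25, 28] (.split 1 (steps [63, 64, 76, 17] .done) (steps [19,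
                63, 36, 65] (.split 1 (steps [6] .done) (steps [0] .done))))) (by decide +kernel)))
            (.branch 41
              (.branch 50
                (.leaf 90 (steps [42, 52, 37, 57, 40, 54, 39, 34, 36, 51, 56, 55, 58, 33, 29, 60,
                  49, 30, 61, 26, 28] (.split 1 (steps [67, 17, 17] .done) (steps [20, 72, 53, 64]
                  (.split 1 (steps [6] .done) (steps [0] .done))))) (by decide +kernel))
                (.leaf 90 (steps [56, 38, 62, 32, 48, 37, 58, 52, 36, 49, 39, 61, 60, 40, 34, 33,
                  31, 57, 64, 63, 28] (.split 1 (steps [54, 17] .done) (steps [23, 74, 59, 55]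
                  (.split 1 (steps [6] .done) (steps [0] .done))))) (by decide +kernel)))
              (.leaf 90 (steps [53, 35, 59, 29, 49, 39, 33, 40, 55, 48, 52, 57, 37, 61, 51, 42, 31,
                30, 66, 54, 28, 69] (.split 1 (steps [72, 65, 17] .done) (steps [34, 74, 6] .done)))
                (by decide +kernel))))
          (.branch 42
            (.branch 47
              (.leaf 90 (steps [48, 40, 52, 36, 50, 56, 34, 38, 39, 37, 30, 54, 58, 32, 35, 55, 31,
                27, 63, 53, 59, 61, 57, 41, 69] (.split 1 (steps [22, 17] .done) (steps [9, 33, 6]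
                .done))) (by decide +kernel))
              (.leaf 90 (steps [41, 39, 50, 51, 35, 53, 54, 48, 40, 38, 34, 52, 36, 58, 31, 57, 59,
                60, 61, 66, 56, 22] (.split 1 (steps [74, 32, 17] .done) (steps [14, 20, 6] .done)))
                (by decide +kernel)))
            (.leaf 90 (steps [40, 38, 48, 36, 52, 32, 37, 30, 56, 50, 49, 58, 34, 33, 31, 55, 54,
              53, 62, 57, 59, 29, 73] (.split 1 (steps [68, 21, 67, 17] .done) (steps [68, 21, 24,
              25] (.split 1 (steps [6] .done) (steps [11, 0] .done))))) (by decide +kernel))))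
        (.branch 42
          (.branch 48
            (.branch 43
              (.leaf 90 (steps [47, 41, 51, 39, 49, 53, 37, 55, 61, 57, 35, 63, 52, 59, 58, 36, 40,
                62, 66, 56, 50, 25] (.split 1 (steps [74, 17, 18, 17] .done) (steps [29, 28, 60, 32]
                (.split 1 (steps [6] .done) (steps [0] .done))))) (by decide +kernel))
              (.leaf 90 (steps [49, 40, 52, 37, 34, 58, 54, 51, 36, 56, 47, 32, 60, 35, 53, 38, 57,
                63, 29, 66, 41, 69] (.split 1 (steps [65, 67, 62, 17] .done) (steps [65, 30, 59, 50]
                (.split 1 (steps [6] .done) (steps [0] .done))))) (by decide +kernel)))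
            (.leaf 90 (steps [52, 40, 49, 36, 56, 47, 41, 34, 38, 43, 54, 60, 53, 55, 37, 57, 35,
              59, 33, 31, 61, 58, 29] (.split 1 (steps [63, 76, 72, 17] .done) (steps [30, 15, 62,
              69] (.split 1 (steps [67, 6] .done) (steps [65, 68, 0] .done)))))
              (by decide +kernel)))
          (.leaf 90 (steps [50, 54, 38, 34, 41, 43, 49, 56, 52, 47, 36, 30, 37, 35, 53, 55, 33, 57,
            31, 59, 29, 60, 32, 27] (.split 1 (steps [68, 69, 75, 17] .done) (steps [19, 21, 64, 68]
            (.split 1 (steps [6] .done) (steps [0] .done))))) (by decide +kernel)))))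
    (.branch 44
      (.branch 46
        (.branch 43
          (.branch 47
            (.branch 42
              (.leaf 90 (steps [48, 40, 50, 51, 39, 55, 38, 35, 52, 41, 37, 53, 59, 57, 31, 58, 67,
                61, 65, 64, 56, 62] (.split 1 (steps [36, 17, 22, 17] .done) (steps [27, 19, 36, 71]
                (.split 1 (steps [6] .done) (steps [34, 0] .done))))) (by decide +kernel))
              (.leaf 90 (steps [48, 39, 51, 36, 35, 40, 55, 49, 52, 53, 31, 37, 41, 59, 32, 63, 29,
                34, 58, 60, 23, 64] (.split 1 (steps [26, 75, 65, 17] .done) (steps [25, 22, 72, 54]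
                (.split 1 (steps [6] .done) (steps [73, 74, 0] .done))))) (by decide +kernel)))
            (.branch 49
              (.leaf 90 (steps [42, 48, 52, 40, 50, 54, 38, 56, 62, 58, 36, 60, 39, 53, 59, 30, 51,
                37, 32, 61, 64, 67] (.split 1 (steps [76, 31, 65, 33, 17] .done) (steps [63, 26, 21,
                74] (.split 1 (steps [31, 6] .done) (steps [22, 0] .done))))) (by decide +kernel))
              (.leaf 90 (steps [41, 53, 57, 37, 50, 48, 42, 35, 39, 55, 61, 54, 38, 56, 58, 59, 67,
                36, 62, 60, 32, 31] (.split 1 (steps [79, 40, 17] .done) (steps [30, 21, 20, 40]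
                (.split 1 (steps [6] .done) (steps [0] .done))))) (by decide +kernel))))
          (.branch 47
            (.branch 41
              (.leaf 90 (steps [51, 48, 39, 42, 33, 50, 38, 40, 31, 36, 35, 53, 29, 34, 54, 28, 55,
                52, 62, 61, 60, 64, 49, 25, 56] (.split 1 (steps [70, 63, 58, 17] .done) (steps [17,
                8, 69, 6] .done))) (by decide +kernel))
              (.leaf 90 (steps [49, 53, 37, 33, 40, 42, 48, 55, 51, 35, 29, 36, 32, 54, 31, 52, 59,
                30, 58, 63, 34, 56] (.split 1 (steps [75, 79, 20, 82, 17] .done) (steps [26, 14, 60,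
                73] (.split 1 (steps [6] .done) (steps [0] .done))))) (by decide +kernel)))
            (.leaf 90 (steps [39, 51, 55, 35, 31, 59, 36, 54, 50, 52, 61, 37, 57, 65, 58, 56, 34,
              48, 32, 38, 28] (.split 1 (steps [75, 67, 33, 17] .done) (steps [25, 10, 73] (.split 1
              (steps [6] .done) (steps [0] .done))))) (by decide +kernel))))
        (.branch 47
          (.branch 43
            (.branch 42
              (.branch 48
                (.leaf 90 (steps [41, 49, 51, 39, 52, 53, 55, 38, 37, 35, 57, 59, 58, 54, 67, 65,
                  36, 56, 60, 63, 23, 33, 19, 34] (.split 1 (steps [25, 77, 17] .done) (steps [40,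
                  6] .done))) (by decide +kernel))
                (.leaf 90 (steps [51, 54, 50, 52, 40, 56, 53, 39, 37, 55, 57, 36, 59, 35, 34, 33,
                  58, 32, 49, 62, 61] (.split 1 (steps [60, 88, 38, 31, 17] .done) (steps [18, 28,
                  21, 68] (.split 1 (steps [6] .done) (steps [0] .done))))) (by decide +kernel)))
              (.leaf 90 (steps [50, 48, 39, 38, 40, 52, 51, 35, 56, 32, 34, 36, 55, 37, 29, 31, 58,
                57, 59, 60] (.split 1 (steps [75, 20, 54, 17] .done) (steps [20, 22, 49] (.split 1
                (steps [6] .done) (steps [0] .done))))) (by decide +kernel)))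
            (.leaf 90 (steps [49, 40, 41, 37, 52, 31, 55, 35, 38, 48, 51, 57, 54, 39, 34, 56, 63,
              32, 30, 50, 59, 42, 29] (.split 1 (steps [20, 60, 62, 69, 22, 17] .done) (steps [20,
              60, 28, 58] (.split 1 (steps [6] .done) (steps [0] .done))))) (by decide +kernel)))
          (.branch 43
            (.leaf 90 (steps [49, 51, 41, 53, 37, 57, 52, 59, 33, 39, 40, 31, 55, 56, 58, 34, 35,
              36, 27, 32, 60, 62, 30] (.split 1 (steps [61, 67, 38, 63, 17] .done) (steps [61, 24,
              75, 25] (.split 1 (steps [6] .done) (steps [0] .done))))) (by decide +kernel))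
            (.leaf 90 (steps [39, 51, 35, 55, 40, 37, 31, 59, 53, 52, 36, 34, 56, 58, 57, 33, 60,
              65, 38, 32, 30] (.split 1 (steps [62, 42, 17] .done) (steps [20, 29, 24] (.split 1
              (steps [6] .done) (steps [0] .done))))) (by decide +kernel)))))
      (.branch 46
        (.branch 43
          (.branch 47
            (.branch 42
              (.leaf 90 (steps [48, 40, 52, 36, 54, 49, 50, 38, 37, 51, 53, 62, 34, 41, 30, 57, 58,
                32, 33, 61, 60, 64, 31, 39, 55] (.split 1 (steps [76, 25, 17] .done) (steps [74, 65,
                6] .done))) (by decide +kernel))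
              (.leaf 90 (steps [48, 39, 36, 40, 51, 35, 55, 49, 37, 53, 33, 31, 59, 41, 56, 32, 58,
                29, 64, 28, 60, 57] (.split 1 (steps [67, 62, 52, 17] .done) (steps [67, 65, 74, 62]
                (.split 1 (steps [6] .done) (steps [0] .done))))) (by decide +kernel)))
            (.leaf 90 (steps [50, 41, 53, 49, 38, 51, 59, 37, 52, 57, 48, 55, 39, 33, 36, 61, 34,
              54, 58, 60, 32, 30, 70] (.split 1 (steps [27, 17, 56, 78, 17] .done) (steps [31, 27,
              65, 66] (.split 1 (steps [28, 6] .done) (steps [63, 0] .done)))))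
              (by decide +kernel)))
          (.branch 47
            (.leaf 90 (steps [41, 39, 49, 37, 53, 33, 38, 31, 57, 51, 50, 59, 35, 32, 36, 54, 56,
              55, 30, 63, 64, 58, 34] (.split 1 (steps [69, 66, 68, 17] .done) (steps [68, 69, 29,
              8] (.split 1 (steps [60, 6] .done) (steps [60, 0] .done))))) (by decide +kernel))
            (.leaf 90 (steps [39, 51, 35, 55, 50, 53, 59, 31, 37, 38, 54, 56, 34, 32, 33, 25, 30,
              36, 52, 58, 63] (.split 1 (steps [74, 62, 17] .done) (steps [18, 19, 48] (.split 1
              (steps [6] .done) (steps [0] .done))))) (by decide +kernel))))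
        (.branch 42
          (.leaf 90 (steps [50, 48, 40, 52, 36, 56, 51, 58, 32, 38, 39, 54, 60, 57, 53, 35, 34, 33,
            59, 31, 61, 64, 55, 75] (.split 1 (steps [69, 27, 17] .done) (steps [29, 18, 14, 72]
            (.split 1 (steps [6] .done) (steps [0] .done))))) (by decide +kernel))
          (.leaf 90 (steps [50, 38, 54, 34, 39, 36, 30, 51, 35, 52, 58, 33, 55, 53, 31, 57, 59, 37,
            56, 29, 28, 61] (.split 1 (steps [64, 20, 17] .done) (steps [24, 17, 71] (.split 1
            (steps [6] .done) (steps [23, 19, 0] .done))))) (by decide +kernel)))))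

lemma refuted_middle : Refuted 30 [(6, 85), (3, 82), (0, 81)] [] [] :=
  .branch 50
    (.branch 49
      (.branch 51
        (.branch 48
          (.branch 52
            (.leaf 85 (steps [59, 65, 41, 56, 35, 54, 44, 60, 46, 61, 45, 34, 55, 63, 66, 37, 62,
              31, 33, 42, 25, 27, 28, 24, 16, 68, 6] .done) (by decide +kernel))
            (.branch 47
              (.branch 58
                (.branch 40
                  (.leaf 85 (steps [53, 55, 45, 60, 59, 43, 31, 67, 61, 57, 44, 33, 41, 54, 64, 65,
                    27, 62, 68, 71, 32, 42, 24, 28, 38, 72, 6] .done) (by decide +kernel))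
                  (.leaf 85 (steps [64, 37, 43, 45, 38, 41, 53, 66, 42, 54, 39, 65, 57, 62, 44, 56,
                    63, 35, 33, 67, 77, 21, 31, 68, 6] .done) (by decide +kernel)))
                (.leaf 85 (steps [34, 61, 55, 53, 60, 57, 56, 32, 45, 44, 59, 63, 33, 68, 41, 65,
                  29, 31, 27, 39, 62, 77, 6] .done) (by decide +kernel)))
              (.branch 57
                (.branch 42
                  (.leaf 85 (steps [54, 45, 59, 53, 61, 63, 43, 65, 39, 46, 56, 41, 33, 67, 58, 34,
                    44, 71, 31, 28, 37, 73, 60, 62, 6] .done) (by decide +kernel))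
                  (.leaf 85 (steps [62, 72, 32, 56, 38, 44, 45, 60, 54, 64, 53, 59, 61, 66, 70, 46,
                    36, 43, 74, 73, 35, 69, 22] (.split 1 (steps [83, 6] .done) (steps [13, 77, 6,
                    3] (.split 1 (steps [3] .done) (steps [0] .done))))) (by decide +kernel)))
                (.leaf 85 (steps [67, 27, 56, 55, 63, 59, 65, 66, 35, 61, 54, 45, 46, 41, 69, 60,
                  44, 58, 32, 79, 9, 24, 64, 6] .done) (by decide +kernel)))))
          (.branch 52
            (.branch 53
              (.branch 42
                (.leaf 85 (steps [60, 66, 57, 55, 62, 61, 47, 45, 56, 65, 64, 67, 63, 70, 43, 33,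
                  46, 73, 35, 44, 68, 29, 28, 71, 24, 37, 36, 80, 6] .done) (by decide +kernel))
                (.leaf 85 (steps [46, 44, 45, 47, 40, 41, 28, 55, 56, 37, 35, 59, 38, 32, 29, 31,
                  61, 23, 63, 6] .done) (by decide +kernel)))
              (.branch 43
                (.branch 58
                  (.leaf 85 (steps [55, 46, 60, 54, 62, 64, 42, 34, 45, 66, 40, 57, 61, 41, 35, 36,
                    67, 69, 72, 33, 22, 79, 56, 6] .done) (by decide +kernel))
                  (.leaf 85 (steps [68, 28, 56, 57, 64, 60, 66, 67, 36, 62, 44, 42, 55, 47, 46, 61,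
                    45, 70, 33, 79, 59, 31, 24, 54, 6] .done) (by decide +kernel)))
                (.leaf 85 (steps [63, 73, 33, 56, 54, 42, 64, 44, 62, 66, 55, 65, 45, 59, 70, 67,
                  40, 57, 29, 47, 36, 24, 77, 39] (.split 1 (steps [6] .done) (steps [3] .done)))
                  (by decide +kernel))))
            (.branch 44
              (.branch 56
                (.leaf 85 (steps [55, 62, 34, 68, 58, 53, 47, 42, 46, 60, 66, 59, 61, 70, 38, 63,
                  65, 39, 29, 36, 33, 14, 57, 67, 6] .done) (by decide +kernel))
                (.leaf 85 (steps [40, 58, 54, 55, 57, 64, 59, 62, 66, 65, 61, 38, 53, 42, 34, 70,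
                  41, 39, 35, 67, 31, 71, 27, 37, 23, 7, 25] (.split 1 (steps [6] .done) (steps [3]
                  .done))) (by decide +kernel)))
              (.leaf 85 (steps [60, 42, 28, 46, 43, 34, 38, 41, 45, 35, 53, 57, 59, 61, 47, 33, 31,
                37, 63, 29, 32, 22, 69, 54, 6] .done) (by decide +kernel)))))
        (.branch 48
          (.branch 52
            (.branch 47
              (.branch 46
                (.leaf 85 (steps [57, 54, 44, 63, 39, 42, 58, 55, 32, 56, 64, 53, 40, 62, 67, 43,
                  69, 35, 29, 28, 68, 71, 41, 77] (.split 1 (steps [72, 6] .done) (steps [38, 3]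
                  .done))) (by decide +kernel))
                (.leaf 85 (steps [56, 61, 41, 36, 44, 40, 58, 34, 60, 62, 53, 57, 68, 55, 42, 43,
                  54, 33, 65, 59, 39, 32, 31, 71, 12, 72, 6] .done) (by decide +kernel)))
              (.leaf 85 (steps [55, 43, 59, 39, 46, 44, 41, 61, 58, 54, 57, 37, 65, 33, 53, 29, 40,
                69, 60, 34, 32, 28, 68, 24, 74, 38, 31, 6] .done) (by decide +kernel)))
            (.branch 53
              (.leaf 85 (steps [56, 61, 41, 46, 58, 45, 57, 47, 59, 43, 65, 33, 60, 63, 42, 54, 64,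
                68, 40, 67, 77, 31, 37, 29, 39, 70, 55, 6] .done) (by decide +kernel))
              (.leaf 85 (steps [55, 57, 47, 39, 46, 41, 65, 58, 59, 45, 37, 33, 61, 43, 42, 40, 64,
                62, 69, 38, 32, 29, 27, 63, 21, 66, 56, 6] .done) (by decide +kernel))))
          (.branch 54
            (.branch 45
              (.leaf 85 (steps [52, 44, 58, 56, 40, 46, 62, 55, 53, 59, 60, 38, 64, 66, 41, 34, 37,
                61, 47, 26, 74, 29, 68, 36, 32, 6, 67, 6] .done) (by decide +kernel))
              (.leaf 85 (steps [57, 33, 47, 43, 46, 58, 38, 41, 52, 44, 40, 56, 62, 64, 61, 35, 59,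
                28, 32, 29, 23, 55, 67, 6] .done) (by decide +kernel)))
            (.leaf 85 (steps [42, 60, 36, 52, 53, 41, 61, 56, 58, 47, 55, 43, 37, 59, 64, 35, 38,
              67, 65, 33, 62, 32, 20, 74, 46, 6] .done) (by decide +kernel)))))
      (.branch 51
        (.branch 48
          (.branch 52
            (.branch 47
              (.leaf 85 (steps [56, 54, 44, 53, 46, 43, 39, 42, 55, 57, 37, 33, 41, 35, 29, 36, 27,
                67, 60, 65, 23, 15, 68, 34, 69] (.split 1 (steps [58, 6] .done) (steps [25, 63, 70,
                3] (.split 1 (steps [3] .done) (steps [0] .done))))) (by decide +kernel))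
              (.leaf 85 (steps [45, 43, 37, 57, 61, 54, 44, 46, 63, 39, 59, 55, 35, 36, 56, 38, 67,
                58, 31, 65, 62, 29, 28, 27, 33, 64, 42, 6] .done) (by decide +kernel)))
            (.branch 46
              (.branch 55
                (.leaf 85 (steps [47, 57, 42, 62, 45, 59, 44, 54, 56, 61, 41, 63, 39, 38, 65, 71,
                  36, 26, 64, 27, 25, 24, 35, 33] (.split 1 (steps [6] .done) (steps [43, 77, 80, 3]
                  (.split 1 (steps [3] .done) (steps [0] .done))))) (by decide +kernel))
                (.leaf 85 (steps [43, 67, 53, 57, 42, 63, 54, 44, 47, 66, 60, 65, 38, 26, 35, 59,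
                  29, 36, 69, 32, 12, 16, 6] .done) (by decide +kernel)))
              (.leaf 85 (steps [58, 34, 64, 54, 44, 42, 47, 39, 59, 53, 57, 33, 41, 62, 36, 68, 65,
                60, 74, 35, 27, 72, 61, 6] .done) (by decide +kernel))))
          (.branch 47
            (.branch 52
              (.leaf 85 (steps [53, 45, 57, 41, 55, 61, 44, 43, 39, 42, 35, 59, 63, 31, 60, 62, 38,
                36, 46, 29, 33, 68, 32, 78, 76, 23, 67, 6] .done) (by decide +kernel))
              (.leaf 85 (steps [56, 44, 46, 40, 55, 58, 59, 53, 45, 43, 39, 57, 41, 63, 36, 62, 64,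
                38, 71, 65, 27, 68, 19, 70, 60, 6] .done) (by decide +kernel)))
            (.branch 45
              (.leaf 85 (steps [56, 52, 42, 40, 54, 58, 55, 41, 61, 60, 34, 39, 59, 38, 62, 36, 65,
                37, 33, 31, 25, 64, 53, 68, 6] .done) (by decide +kernel))
              (.leaf 85 (steps [53, 41, 57, 37, 42, 35, 61, 55, 54, 63, 59, 56, 67, 58, 31, 62, 36,
                38, 40, 60, 72, 29, 26, 76, 28] (.split 1 (steps [6] .done) (steps [70, 3] .done)))
                (by decide +kernel)))))
        (.branch 47
          (.branch 53
            (.branch 48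
              (.leaf 85 (steps [56, 41, 61, 44, 37, 39, 63, 59, 35, 43, 57, 58, 52, 60, 40, 42, 67,
                46, 27, 26, 34, 54, 29, 71, 36, 19, 23, 76] (.split 1 (steps [6] .done) (steps [3]
                .done))) (by decide +kernel))
              (.leaf 85 (steps [54, 45, 57, 42, 33, 63, 39, 59, 56, 41, 37, 52, 61, 65, 43, 40, 60,
                46, 34, 23, 29, 27, 36, 67, 75, 69, 6] .done) (by decide +kernel)))
            (.leaf 85 (steps [45, 57, 54, 41, 61, 52, 46, 39, 43, 48, 59, 65, 58, 42, 60, 62, 40,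
              64, 38, 66, 34, 23, 35, 32, 20, 25] (.split 1 (steps [77, 6] .done) (steps [72, 3]
              .done))) (by decide +kernel)))
          (.leaf 85 (steps [55, 43, 46, 59, 39, 48, 54, 61, 60, 56, 65, 58, 42, 40, 38, 37, 36, 34,
            64, 62, 26, 52, 32, 25, 29, 76, 44, 6] .done) (by decide +kernel)))))
    (.branch 49
      (.branch 51
        (.branch 48
          (.branch 52
            (.branch 47
              (.leaf 85 (steps [53, 45, 55, 56, 44, 60, 43, 57, 46, 42, 58, 32, 64, 40, 63, 66, 62,
                39, 72, 31, 33, 34, 28, 76, 25, 41, 80, 70, 61, 6] .done) (by decide +kernel))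
              (.leaf 85 (steps [53, 44, 56, 41, 60, 55, 57, 40, 45, 43, 37, 39, 61, 63, 58, 34, 36,
                28, 38, 31, 25, 18, 71, 72, 59, 62, 6] .done) (by decide +kernel)))
            (.branch 54
              (.leaf 85 (steps [47, 53, 57, 45, 55, 59, 43, 61, 67, 63, 65, 41, 39, 33, 64, 46, 56,
                31, 40, 37, 29, 44, 32, 79, 72, 70, 20, 34, 6] .done) (by decide +kernel))
              (.leaf 85 (steps [58, 46, 42, 62, 55, 53, 47, 40, 44, 36, 45, 41, 32, 64, 43, 63, 60,
                65, 67, 61, 35, 37, 71, 68, 23, 59, 6] .done) (by decide +kernel))))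
          (.branch 52
            (.branch 46
              (.leaf 85 (steps [47, 53, 43, 55, 45, 41, 57, 39, 33, 37, 59, 31, 25, 36, 61, 44, 32,
                71, 54, 63, 40, 22, 27, 21, 28, 13, 29, 6] .done) (by decide +kernel))
              (.leaf 85 (steps [54, 42, 58, 38, 45, 47, 53, 60, 56, 64, 55, 59, 37, 68, 36, 57, 63,
                33, 35, 31, 41, 25, 34, 19, 70, 74, 6] .done) (by decide +kernel)))
            (.leaf 85 (steps [56, 44, 40, 60, 64, 36, 32, 41, 59, 38, 43, 34, 45, 58, 47, 57, 61,
              39, 63, 33, 65, 67, 24, 73, 62, 53, 6] .done) (by decide +kernel))))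
        (.branch 52
          (.branch 48
            (.branch 47
              (.leaf 85 (steps [56, 61, 41, 46, 44, 58, 55, 45, 57, 43, 59, 42, 60, 62, 35, 63, 29,
                37, 65, 38, 25, 69, 28, 80, 13, 54, 64, 6] .done) (by decide +kernel))
              (.leaf 85 (steps [53, 55, 44, 43, 59, 41, 40, 46, 54, 56, 64, 38, 58, 34, 60, 36, 63,
                62, 67, 66, 76, 32, 35, 16, 73, 6] .done) (by decide +kernel)))
            (.leaf 85 (steps [54, 45, 46, 42, 57, 66, 56, 53, 58, 60, 44, 43, 59, 37, 41, 39, 38,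
              40, 64, 61, 67, 65, 63, 25, 36, 29, 31, 14, 62, 6] .done) (by decide +kernel)))
          (.branch 48
            (.leaf 85 (steps [54, 56, 46, 58, 42, 62, 57, 64, 38, 44, 45, 36, 66, 63, 61, 39, 68,
              40, 37, 32, 41, 67, 18, 20, 13, 17, 73, 60, 76] (.split 1 (steps [6] .done) (steps [3]
              .done))) (by decide +kernel))
            (.leaf 85 (steps [44, 56, 40, 60, 45, 42, 47, 55, 58, 38, 64, 39, 41, 61, 59, 37, 65,
              62, 74, 34, 33, 27, 22] (.split 1 (steps [6] .done) (steps [69, 3] .done)))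
              (by decide +kernel)))))
      (.branch 51
        (.branch 48
          (.branch 52
            (.branch 47
              (.leaf 85 (steps [53, 45, 57, 41, 59, 54, 55, 43, 42, 35, 46, 37, 63, 39, 38, 31, 27,
                34, 65, 25, 58, 62, 29, 24, 28, 73, 6] .done) (by decide +kernel))
              (.leaf 85 (steps [53, 44, 45, 41, 56, 40, 54, 42, 58, 36, 38, 60, 34, 46, 64, 37, 61,
                24, 55, 28, 33, 63, 72, 16, 75, 6] .done) (by decide +kernel)))
            (.leaf 85 (steps [46, 55, 58, 54, 43, 56, 64, 42, 57, 62, 53, 60, 38, 44, 41, 61, 39,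
              35, 65, 36, 69, 63, 24, 33, 32, 34, 12, 79, 28, 6] .done) (by decide +kernel)))
          (.branch 52
            (.leaf 85 (steps [46, 44, 54, 42, 58, 38, 43, 40, 56, 34, 55, 62, 64, 60, 57, 68, 61,
              39, 37, 63, 35, 69, 29, 65, 24, 45, 25, 41, 18] (.split 1 (steps [6] .done) (steps [3]
              .done))) (by decide +kernel))
            (.leaf 85 (steps [44, 56, 40, 60, 55, 58, 64, 36, 42, 43, 34, 59, 41, 61, 39, 37, 35,
              63, 33, 27, 65, 69, 73, 77, 53, 6] .done) (by decide +kernel))))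
        (.branch 47
          (.leaf 85 (steps [55, 53, 45, 57, 41, 61, 56, 63, 37, 43, 44, 35, 59, 60, 39, 42, 38, 31,
            40, 62, 36, 65, 25, 28, 64, 78, 74, 6] .done) (by decide +kernel))
          (.leaf 85 (steps [55, 43, 59, 39, 44, 41, 35, 63, 57, 56, 65, 61, 58, 40, 62, 69, 64, 38,
            33, 36, 31, 27] (.split 1 (steps [28, 46, 6] .done) (steps [20, 6, 68] (.split 1 (steps
            [3] .done) (steps [0] .done))))) (by decide +kernel)))))

lemma refuted_high : Refuted 40 [(7, 87), (5, 85), (1, 83), (0, 81)] [] [] :=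
  .branch 57
    (.branch 56
      (.branch 58
        (.branch 55
          (.branch 59
            (.branch 48
              (.branch 66
                (.leaf 87 (steps [53, 51, 61, 46, 62, 47, 63, 45, 43, 49, 75, 39, 65, 42, 41, 38,
                  37, 35, 34, 26, 28, 31, 25, 29, 32, 13, 16] (.split 2 (steps [7] .done) (steps [1]
                  .done))) (by decide +kernel))
                (.leaf 87 (steps [42, 69, 63, 61, 68, 65, 64, 53, 52, 67, 41, 71, 43, 49, 39, 47,
                  37, 35, 36, 50, 28, 70, 33, 23] (.split 2 (steps [79, 25, 7] .done) (steps [31,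
                  26, 77, 10] (.split 1 (steps [1] .done) (steps [0] .done)))))
                  (by decide +kernel)))
              (.leaf 87 (steps [36, 45, 52, 51, 53, 46, 38, 49, 47, 34, 61, 62, 65, 44, 35, 43, 37,
                33, 63, 29, 71, 23] (.split 2 (steps [67, 7] .done) (steps [67, 1] .done)))
                (by decide +kernel)))
            (.branch 54
              (.branch 65
                (.branch 47
                  (.branch 60
                    (.leaf 87 (steps [52, 62, 50, 66, 38, 74, 44, 48, 42, 51, 37, 64, 43, 39, 36,
                      63, 49, 25, 35, 33, 27, 67, 70, 77, 45] (.split 2 (steps [7] .done) (steps [1]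
                      .done))) (by decide +kernel))
                    (.leaf 87 (steps [67, 46, 74, 39, 29, 38, 49, 52, 50, 62, 44, 41, 43, 37, 51,
                      73, 69, 63, 70, 31, 28, 33, 30, 27, 72, 7] .done) (by decide +kernel)))
                  (.leaf 87 (steps [35, 44, 51, 50, 52, 37, 45, 46, 60, 73, 61, 33, 39, 64, 42, 36,
                    69, 63, 70, 32, 34, 28, 11] (.split 2 (steps [78, 7] .done) (steps [49, 1]
                    .done))) (by decide +kernel)))
                (.leaf 87 (steps [41, 68, 77, 62, 61, 60, 67, 64, 66, 52, 39, 51, 69, 48, 43, 42,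
                  37, 36, 28, 34, 33, 80, 49, 24] (.split 2 (steps [63, 7] .done) (steps [63, 1]
                  .done))) (by decide +kernel)))
              (.branch 64
                (.branch 49
                  (.leaf 87 (steps [61, 52, 66, 60, 68, 62, 70, 72, 48, 51, 63, 43, 41, 53, 42, 67,
                    46, 45, 39, 34, 35, 31, 75, 24, 44, 38, 50, 7] .done) (by decide +kernel))
                  (.branch 69
                    (.leaf 87 (steps [39, 79, 24, 63, 45, 51, 52, 67, 41, 61, 37, 48, 43, 47, 36,
                      65, 62, 33, 38, 25, 35, 60, 29, 77, 73] (.split 2 (steps [7] .done) (steps [1]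
                      .done))) (by decide +kernel))
                    (.leaf 87 (steps [29, 63, 65, 71, 72, 47, 61, 60, 48, 43, 51, 33, 37, 46, 41,
                      28, 26, 35, 32, 12, 24, 27] (.split 2 (steps [7] .done) (steps [1] .done)))
                      (by decide +kernel))))
                (.branch 44
                  (.leaf 87 (steps [63, 62, 65, 53, 61, 47, 43, 51, 45, 37, 46, 42, 67, 50, 70, 33,
                    41, 35, 34, 29, 78, 32, 17, 26, 18, 71] (.split 2 (steps [7] .done) (steps [1]
                    .done))) (by decide +kernel))
                  (.leaf 87 (steps [29, 63, 62, 46, 48, 50, 42, 45, 53, 65, 51, 43, 37, 67, 33, 73,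
                    22, 19, 28, 76] (.split 2 (steps [7] .done) (steps [1] .done)))
                    (by decide +kernel))))))
          (.branch 59
            (.branch 60
              (.branch 49
                (.branch 67
                  (.leaf 87 (steps [54, 52, 62, 68, 64, 48, 46, 42, 53, 45, 39, 44, 66, 63, 38, 35,
                    41, 51, 36, 43, 37, 71, 19, 27, 23, 29] (.split 2 (steps [76, 7] .done) (steps
                    [65, 1] .done))) (by decide +kernel))
                  (.leaf 87 (steps [43, 70, 64, 62, 69, 66, 65, 54, 53, 41, 68, 71, 45, 39, 42, 44,
                    63, 50, 36, 38, 37, 29, 48, 8, 79, 76, 7] .done) (by decide +kernel)))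
                (.leaf 87 (steps [37, 46, 53, 52, 54, 39, 47, 50, 48, 35, 45, 63, 62, 36, 66, 44,
                  71, 33, 30, 28, 15, 79, 77, 7] .done) (by decide +kernel)))
              (.branch 50
                (.leaf 87 (steps [65, 70, 53, 62, 46, 54, 48, 66, 44, 64, 68, 63, 43, 49, 42, 45,
                  38, 67, 36, 51, 32, 34, 30, 29, 39, 27, 17, 76, 77, 7] .done) (by decide +kernel))
                (.leaf 87 (steps [70, 30, 54, 48, 42, 46, 51, 52, 62, 68, 64, 47, 44, 66, 63, 53,
                  38, 41, 67, 39, 35, 37, 36, 32, 34, 31, 29, 26, 27, 73, 7] .done)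
                  (by decide +kernel))))
            (.branch 51
              (.branch 63
                (.leaf 87 (steps [54, 60, 50, 52, 49, 69, 66, 62, 68, 61, 48, 46, 70, 44, 53, 36,
                  64, 42, 37, 43, 32, 35, 39, 25, 20, 71, 11] (.split 2 (steps [7] .done) (steps
                  [67, 1] .done))) (by decide +kernel))
                (.leaf 87 (steps [71, 47, 65, 64, 61, 73, 66, 69, 62, 52, 49, 54, 41, 45, 48, 37,
                  44, 50, 36, 74, 35, 23, 33, 39, 31, 25, 79, 7] .done) (by decide +kernel)))
              (.leaf 87 (steps [67, 43, 49, 75, 35, 50, 45, 48, 41, 53, 42, 52, 60, 62, 29, 36, 44,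
                66, 38, 65, 39, 25, 23, 19, 26, 30, 61, 12] (.split 2 (steps [7] .done) (steps [1]
                .done))) (by decide +kernel)))))
        (.branch 55
          (.branch 59
            (.branch 54
              (.branch 53
                (.leaf 87 (steps [61, 64, 51, 70, 49, 65, 62, 39, 47, 37, 41, 63, 69, 43, 50, 36,
                  33, 38, 32, 35, 46, 30, 21, 27, 60, 19, 12] (.split 2 (steps [77, 7] .done) (steps
                  [1] .done))) (by decide +kernel))
                (.branch 63
                  (.leaf 87 (steps [61, 65, 69, 77, 51, 47, 41, 45, 67, 60, 71, 62, 48, 50, 39, 68,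
                    52, 37, 36, 35, 49, 33, 34, 30, 26, 23] (.split 2 (steps [70, 7] .done) (steps
                    [72, 73, 1] .done))) (by decide +kernel))
                  (.branch 43
                    (.leaf 87 (steps [62, 71, 64, 52, 50, 44, 42, 51, 49, 45, 37, 41, 69, 36, 66,
                      67, 35, 39, 46, 27, 23, 24, 73, 72, 75, 7] .done) (by decide +kernel))
                    (.leaf 87 (steps [28, 60, 64, 46, 52, 44, 42, 50, 62, 66, 41, 51, 49, 35, 38,
                      32, 34, 36, 11, 72, 65, 7] .done) (by decide +kernel)))))
              (.branch 62
                (.leaf 87 (steps [50, 46, 53, 51, 48, 68, 65, 44, 47, 43, 41, 67, 69, 61, 37, 35,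
                  42, 39, 64, 45, 33, 32, 24, 52, 31, 30, 16] (.split 2 (steps [60, 7] .done) (steps
                  [60, 75, 1] .done))) (by decide +kernel))
                (.leaf 87 (steps [70, 46, 64, 63, 61, 68, 72, 51, 65, 60, 67, 53, 44, 43, 36, 45,
                  41, 32, 33, 37, 35, 28, 47, 31, 30, 76, 80] (.split 2 (steps [7] .done) (steps [1]
                  .done))) (by decide +kernel))))
            (.branch 60
              (.branch 54
                (.branch 53
                  (.leaf 87 (steps [64, 66, 45, 63, 67, 65, 51, 50, 68, 49, 41, 39, 46, 43, 42, 47,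
                    33, 31, 37, 34, 36, 22, 23, 32, 69, 7] .done) (by decide +kernel))
                  (.leaf 87 (steps [63, 43, 65, 51, 47, 52, 66, 64, 42, 62, 50, 37, 71, 45, 39, 49,
                    25, 68, 61, 34, 35, 27, 30, 26, 36, 32, 70, 7] .done) (by decide +kernel)))
                (.leaf 87 (steps [62, 64, 50, 49, 46, 44, 68, 48, 70, 45, 53, 61, 72, 71, 63, 36,
                  67, 41, 39, 35, 33, 73, 28, 24, 8, 21, 66, 12, 7] .done) (by decide +kernel)))
              (.branch 62
                (.leaf 87 (steps [63, 68, 48, 66, 52, 64, 54, 50, 44, 51, 67, 41, 49, 69, 47, 37,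
                  71, 39, 34, 43, 31, 35, 30, 23, 22, 42, 73] (.split 2 (steps [7] .done) (steps [1]
                  .done))) (by decide +kernel))
                (.branch 54
                  (.leaf 87 (steps [65, 53, 68, 66, 52, 67, 63, 51, 69, 49, 71, 43, 45, 42, 47, 31,
                    39, 41, 30, 34, 28, 23, 29, 26, 8, 37] (.split 2 (steps [7] .done) (steps [76,
                    1] .done))) (by decide +kernel))
                  (.leaf 87 (steps [46, 70, 71, 65, 44, 43, 67, 69, 73, 49, 45, 47, 51, 29, 37, 53,
                    26, 33, 23, 30, 72, 7] .done) (by decide +kernel))))))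
          (.branch 61
            (.branch 52
              (.branch 59
                (.branch 54
                  (.leaf 87 (steps [63, 68, 48, 53, 65, 60, 62, 51, 50, 66, 44, 42, 76, 45, 47, 38,
                    36, 41, 39, 32, 29, 31, 69, 33, 19, 70] (.split 2 (steps [7] .done) (steps [1]
                    .done))) (by decide +kernel))
                  (.leaf 87 (steps [62, 50, 66, 46, 60, 53, 63, 44, 51, 48, 68, 45, 67, 69, 36, 42,
                    47, 38, 35, 34, 43, 41, 23, 31, 30, 15, 72, 7] .done) (by decide +kernel)))
                (.leaf 87 (steps [51, 63, 67, 47, 53, 43, 49, 69, 62, 54, 60, 65, 45, 46, 66, 44,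
                  29, 42, 38, 41, 34, 32, 25, 33, 23, 72, 7] .done) (by decide +kernel)))
              (.leaf 87 (steps [64, 46, 54, 70, 65, 45, 50, 66, 51, 63, 47, 69, 42, 62, 41, 68, 59,
                39, 32, 44, 29, 36, 35, 28, 24, 16, 79, 21] (.split 2 (steps [7] .done) (steps [1]
                .done))) (by decide +kernel)))
            (.leaf 87 (steps [49, 67, 43, 73, 59, 63, 53, 60, 65, 68, 48, 54, 50, 69, 71, 41, 42,
              45, 47, 39, 35, 33, 74, 21, 44, 38, 31, 30, 66, 7] .done) (by decide +kernel)))))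
      (.branch 58
        (.branch 55
          (.branch 59
            (.branch 54
              (.branch 60
                (.leaf 87 (steps [61, 62, 51, 63, 53, 50, 49, 65, 69, 43, 44, 37, 39, 45, 35, 67,
                  52, 41, 36, 38, 68, 32, 31, 29, 28, 33, 24] (.split 2 (steps [23, 46, 7] .done)
                  (steps [27, 17, 73, 70] (.split 1 (steps [1] .done) (steps [0] .done)))))
                  (by decide +kernel))
                (.leaf 87 (steps [52, 64, 68, 48, 61, 63, 66, 70, 74, 46, 53, 50, 38, 69, 78, 45,
                  49, 34, 39, 37, 36, 30, 22, 32, 31, 20, 24] (.split 2 (steps [7] .done) (steps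
                  [67, 1] .done))) (by decide +kernel)))
              (.branch 52
                (.leaf 87 (steps [63, 61, 49, 51, 47, 45, 43, 65, 37, 39, 53, 41, 67, 60, 38, 69,
                  42, 75, 66, 50, 36, 34, 25, 30, 19, 26, 79, 74, 7] .done) (by decide +kernel))
                (.leaf 87 (steps [60, 48, 44, 64, 51, 61, 70, 68, 63, 67, 45, 43, 41, 53, 39, 66,
                  42, 38, 32, 34, 37, 35, 30, 27, 18, 79, 72] (.split 2 (steps [7] .done) (steps [1]
                  .done))) (by decide +kernel))))
            (.branch 53
              (.leaf 87 (steps [62, 65, 61, 51, 49, 69, 64, 67, 66, 63, 45, 60, 48, 50, 37, 43, 39,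
                46, 33, 44, 73, 34, 35, 27, 36, 9, 8, 24] (.split 2 (steps [7] .done) (steps [1]
                .done))) (by decide +kernel))
              (.leaf 87 (steps [65, 47, 41, 71, 29, 49, 63, 33, 46, 66, 52, 64, 42, 39, 45, 54, 48,
                37, 43, 67, 27, 70, 69, 22, 25] (.split 2 (steps [75, 7] .done) (steps [60, 1]
                .done))) (by decide +kernel))))
          (.branch 54
            (.branch 59
              (.branch 60
                (.leaf 87 (steps [61, 62, 51, 48, 49, 63, 50, 47, 44, 46, 64, 66, 42, 53, 67, 43,
                  36, 39, 35, 37, 38, 70, 52, 41, 26, 29, 25] (.split 2 (steps [72, 7] .done) (steps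
                  [15, 80, 1] .done))) (by decide +kernel))
                (.leaf 87 (steps [64, 52, 65, 50, 68, 62, 46, 48, 44, 49, 53, 42, 43, 66, 67, 34,
                  38, 51, 30, 32, 39, 33, 41, 78, 31, 23, 80, 7] .done) (by decide +kernel)))
              (.leaf 87 (steps [63, 51, 53, 47, 62, 65, 66, 60, 52, 50, 46, 64, 48, 43, 37, 39, 30,
                29, 33, 73, 45, 25, 27, 31, 23, 24, 77, 15] (.split 2 (steps [7] .done) (steps [1]
                .done))) (by decide +kernel)))
            (.branch 52
              (.leaf 87 (steps [63, 59, 49, 47, 61, 65, 62, 48, 68, 67, 45, 66, 46, 37, 44, 41, 50,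
                43, 39, 69, 36, 33, 31, 77, 21] (.split 2 (steps [15, 82, 30, 11] (.split 1 (steps
                [7] .done) (steps [5] .done))) (steps [15, 70, 1] .done))) (by decide +kernel))
              (.leaf 87 (steps [60, 48, 44, 64, 49, 46, 51, 43, 38, 47, 61, 65, 63, 67, 41, 66, 39,
                69, 42, 26, 34, 29, 23, 31, 74] (.split 2 (steps [59, 7] .done) (steps [59, 1]
                .done))) (by decide +kernel)))))
        (.branch 54
          (.branch 60
            (.branch 55
              (.branch 59
                (.leaf 87 (steps [63, 53, 51, 61, 49, 65, 66, 48, 47, 46, 39, 67, 50, 44, 41, 43,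
                  62, 35, 37, 71, 36, 45, 38, 33, 32, 20, 19, 69, 7] .done) (by decide +kernel))
                (.leaf 87 (steps [62, 53, 50, 65, 68, 44, 48, 51, 66, 70, 46, 42, 49, 67, 69, 64,
                  45, 38, 39, 73, 33, 36, 37, 43, 32, 34, 79] (.split 2 (steps [7] .done) (steps [1]
                  .done))) (by decide +kernel)))
              (.leaf 87 (steps [61, 52, 64, 49, 46, 66, 63, 48, 59, 44, 62, 68, 72, 47, 65, 45, 41,
                37, 53, 39, 71, 25, 31, 36, 24, 27, 33, 26] (.split 2 (steps [81, 7] .done) (steps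
                [50, 1] .done))) (by decide +kernel)))
            (.branch 52
              (.branch 59
                (.leaf 87 (steps [64, 68, 48, 72, 67, 53, 65, 70, 69, 61, 49, 51, 42, 47, 43, 45,
                  71, 46, 33, 38, 73, 31, 75, 32, 26, 39, 25] (.split 2 (steps [50, 7] .done) (steps
                  [50, 1] .done))) (by decide +kernel))
                (.leaf 87 (steps [53, 68, 50, 48, 44, 51, 42, 47, 65, 69, 45, 67, 71, 31, 34, 49,
                  37, 39, 77, 35, 30, 28, 64, 22, 73, 7] .done) (by decide +kernel)))
              (.leaf 87 (steps [61, 68, 55, 44, 50, 51, 59, 42, 49, 43, 47, 45, 69, 65, 71, 34, 63,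
                39, 75, 73, 31, 35, 33, 22, 9] (.split 2 (steps [7] .done) (steps [70, 1] .done)))
                (by decide +kernel))))
          (.branch 62
            (.leaf 87 (steps [55, 53, 50, 46, 66, 61, 68, 64, 63, 72, 67, 65, 49, 45, 43, 44, 41,
              47, 69, 42, 33, 32, 39, 31, 24, 28, 35, 21, 51, 7] .done) (by decide +kernel))
            (.leaf 87 (steps [59, 46, 53, 70, 64, 63, 55, 72, 68, 65, 44, 48, 47, 43, 49, 36, 45,
              67, 38, 32, 41, 29, 23, 27, 69, 7] .done) (by decide +kernel))))))
    (.branch 56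
      (.branch 58
        (.branch 55
          (.branch 59
            (.branch 54
              (.branch 60
                (.leaf 87 (steps [52, 62, 50, 64, 47, 67, 51, 63, 49, 65, 39, 53, 71, 46, 35, 43,
                  61, 38, 37, 41, 66, 34, 48, 36, 32, 28, 31] (.split 2 (steps [74, 7] .done) (steps
                  [74, 1] .done))) (by decide +kernel))
                (.leaf 87 (steps [63, 66, 62, 52, 50, 53, 67, 64, 49, 44, 65, 71, 47, 69, 39, 43,
                  35, 42, 37, 38, 32, 34, 41, 45, 30, 18, 77, 74, 7] .done) (by decide +kernel)))
              (.leaf 87 (steps [60, 51, 63, 48, 45, 47, 52, 49, 61, 43, 67, 41, 65, 64, 44, 35, 50,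
                37, 46, 38, 31, 29, 32, 34, 28, 21, 74, 71, 7] .done) (by decide +kernel)))
            (.branch 61
              (.branch 54
                (.branch 60
                  (.leaf 87 (steps [62, 52, 64, 66, 50, 68, 46, 38, 67, 51, 70, 69, 49, 42, 48, 34,
                    36, 53, 71, 44, 39, 35, 63, 27, 17, 28] (.split 2 (steps [7] .done) (steps [79,
                    1] .done))) (by decide +kernel))
                  (.leaf 87 (steps [63, 66, 45, 51, 52, 67, 50, 46, 68, 64, 47, 53, 69, 37, 43, 44,
                    71, 38, 29, 41, 35, 33, 34, 31, 32, 28] (.split 2 (steps [42, 7] .done) (steps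
                    [72, 1] .done))) (by decide +kernel)))
                (.leaf 87 (steps [64, 49, 51, 52, 62, 66, 69, 60, 71, 65, 67, 37, 48, 44, 47, 41,
                  68, 38, 36, 43, 35, 33, 21, 23, 19, 80, 11] (.split 2 (steps [7] .done) (steps [1]
                  .done))) (by decide +kernel)))
              (.branch 53
                (.leaf 87 (steps [60, 62, 65, 69, 54, 49, 52, 43, 48, 66, 70, 68, 50, 42, 31, 35,
                  39, 71, 33, 44, 34, 27, 30, 45, 78, 7] .done) (by decide +kernel))
                (.leaf 87 (steps [69, 45, 77, 37, 47, 52, 70, 50, 46, 39, 31, 35, 41, 48, 62, 25,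
                  42, 33, 30, 38, 36, 32, 78, 7] .done) (by decide +kernel)))))
          (.branch 59
            (.branch 53
              (.branch 54
                (.leaf 87 (steps [63, 69, 62, 60, 50, 52, 64, 41, 49, 43, 47, 67, 35, 45, 46, 38,
                  39, 33, 36, 42, 70, 23, 61, 76, 32, 27, 44] (.split 2 (steps [65, 7] .done) (steps
                  [65, 1] .done))) (by decide +kernel))
                (.leaf 87 (steps [60, 51, 48, 63, 45, 62, 47, 43, 65, 67, 46, 64, 44, 49, 35, 41,
                  39, 33, 61, 29, 70, 23, 38, 27, 34, 37, 26] (.split 2 (steps [7] .done) (steps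
                  [74, 1] .done))) (by decide +kernel)))
              (.leaf 87 (steps [61, 49, 45, 65, 52, 54, 60, 67, 63, 47, 41, 43, 44, 48, 35, 46, 64,
                31, 66, 29, 42, 38, 23, 72, 28, 27, 34, 20, 73, 7] .done) (by decide +kernel)))
            (.leaf 87 (steps [63, 51, 47, 67, 43, 27, 48, 41, 46, 50, 49, 54, 66, 45, 37, 65, 69,
              42, 64, 35, 29, 31, 25, 62, 34, 20] (.split 2 (steps [12, 14, 7, 80] (.split 1 (steps
              [7] .done) (steps [5] .done))) (steps [74, 1] .done))) (by decide +kernel))))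
        (.branch 59
          (.branch 55
            (.branch 54
              (.branch 60
                (.leaf 87 (steps [53, 61, 63, 51, 64, 65, 67, 50, 49, 47, 70, 39, 46, 43, 35, 71,
                  37, 69, 42, 79, 36, 44, 33, 26, 66, 22, 20] (.split 2 (steps [7] .done) (steps
                  [41, 1] .done))) (by decide +kernel))
                (.leaf 87 (steps [62, 64, 63, 66, 52, 68, 65, 51, 67, 69, 49, 71, 47, 39, 46, 50,
                  41, 43, 35, 45, 32, 31, 28, 25, 34, 29, 26] (.split 2 (steps [7] .done) (steps
                  [73, 1] .done))) (by decide +kernel)))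
              (.leaf 87 (steps [62, 60, 51, 50, 52, 64, 63, 47, 68, 44, 67, 65, 49, 70, 43, 41, 61,
                35, 45, 79, 33, 77, 38, 34, 31, 28, 20, 75, 78, 7] .done) (by decide +kernel)))
            (.branch 61
              (.branch 53
                (.leaf 87 (steps [52, 49, 67, 47, 43, 50, 62, 60, 69, 63, 66, 51, 46, 68, 44, 71,
                  39, 35, 41, 34, 33, 31, 28, 25, 26, 24, 45] (.split 2 (steps [7] .done) (steps [1]
                  .done))) (by decide +kernel))
                (.leaf 87 (steps [63, 52, 49, 48, 43, 47, 41, 46, 60, 64, 65, 67, 42, 66, 35, 71,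
                  39, 44, 38, 68, 27, 29, 32, 72] (.split 2 (steps [80, 7] .done) (steps [80, 1]
                  .done))) (by decide +kernel)))
              (.leaf 87 (steps [53, 49, 65, 67, 51, 50, 54, 69, 68, 48, 66, 45, 42, 35, 47, 38, 44,
                71, 39, 33, 23, 31, 27, 36, 75, 77, 7] .done) (by decide +kernel))))
          (.branch 55
            (.branch 61
              (.leaf 87 (steps [63, 68, 48, 53, 65, 51, 64, 52, 50, 66, 70, 46, 49, 67, 42, 44, 39,
                72, 69, 41, 43, 38, 29, 28, 31, 22, 26, 71] (.split 2 (steps [7] .done) (steps [77,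
                1] .done))) (by decide +kernel))
              (.leaf 87 (steps [65, 53, 69, 49, 64, 71, 70, 43, 51, 45, 52, 47, 48, 39, 67, 46, 68,
                31, 25, 33, 35, 42, 27, 36, 26, 44, 32, 80] (.split 2 (steps [7] .done) (steps [1]
                .done))) (by decide +kernel)))
            (.leaf 87 (steps [63, 51, 67, 47, 52, 45, 35, 46, 43, 39, 48, 50, 41, 33, 64, 29, 37,
              42, 32, 34, 30, 27, 38, 31, 8, 78] (.split 2 (steps [77, 7] .done) (steps [69, 1]
              .done))) (by decide +kernel)))))
      (.branch 58
        (.branch 55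
          (.branch 59
            (.branch 54
              (.branch 60
                (.leaf 87 (steps [53, 61, 49, 65, 63, 69, 64, 50, 51, 67, 47, 71, 43, 39, 46, 48,
                  35, 45, 38, 66, 31, 27, 32, 37, 36, 74, 11, 76, 15, 7] .done) (by decide +kernel))
                (.leaf 87 (steps [52, 64, 68, 62, 63, 50, 51, 46, 49, 53, 38, 47, 69, 73, 67, 70,
                  44, 35, 41, 37, 45, 32, 39, 29, 23, 77, 66, 7] .done) (by decide +kernel)))
              (.leaf 87 (steps [60, 51, 52, 48, 63, 47, 67, 61, 49, 65, 45, 43, 50, 44, 41, 35, 66,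
                37, 53, 68, 34, 31, 71, 75, 25, 26, 14, 10] (.split 2 (steps [62, 7] .done) (steps
                [78, 1] .done))) (by decide +kernel)))
            (.branch 53
              (.leaf 87 (steps [63, 61, 62, 65, 51, 67, 64, 54, 50, 45, 49, 48, 68, 46, 39, 71, 43,
                37, 38, 35, 44, 34, 25, 31, 27, 21, 26, 29] (.split 2 (steps [78, 7] .done) (steps
                [78, 1] .done))) (by decide +kernel))
              (.leaf 87 (steps [61, 65, 49, 47, 41, 63, 64, 60, 51, 46, 66, 48, 43, 69, 37, 72, 42,
                67, 35, 27, 31, 25, 17, 26, 18] (.split 2 (steps [77, 7] .done) (steps [77, 1]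
                .done))) (by decide +kernel))))
          (.branch 59
            (.branch 53
              (.leaf 87 (steps [63, 69, 62, 47, 65, 41, 67, 49, 43, 45, 50, 66, 46, 64, 48, 44, 35,
                37, 70, 26, 42, 72, 39, 27, 80, 22, 18, 17] (.split 2 (steps [7] .done) (steps [1]
                .done))) (by decide +kernel))
              (.leaf 87 (steps [61, 49, 65, 45, 47, 50, 41, 62, 63, 67, 66, 48, 44, 64, 42, 43, 27,
                68, 70, 72, 46, 39, 23, 24, 31, 74, 11, 8] (.split 2 (steps [73, 7] .done) (steps
                [73, 1] .done))) (by decide +kernel)))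
            (.leaf 87 (steps [51, 63, 47, 67, 62, 65, 71, 50, 66, 49, 43, 48, 46, 45, 37, 44, 68,
              39, 29, 73, 33, 35, 34, 32, 25, 38] (.split 2 (steps [70, 7] .done) (steps [79, 1]
              .done))) (by decide +kernel))))
        (.branch 54
          (.branch 60
            (.leaf 87 (steps [63, 68, 48, 44, 51, 50, 64, 70, 66, 72, 67, 46, 49, 45, 69, 43, 47,
              41, 32, 73, 38, 37, 27, 33, 25, 65, 79, 7] .done) (by decide +kernel))
            (.leaf 87 (steps [52, 64, 68, 48, 63, 66, 72, 51, 67, 50, 44, 69, 47, 45, 49, 38, 43,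
              41, 34, 35, 22, 25, 28, 26, 24, 32, 70, 7] .done) (by decide +kernel)))
          (.leaf 87 (steps [62, 50, 66, 46, 51, 48, 42, 63, 47, 68, 70, 65, 67, 45, 69, 41, 44, 71,
            43, 35, 53, 32, 38, 30, 79, 76, 7] .done) (by decide +kernel)))))

end Lanes

/-! ### The upper bound -/

/-- A coloring of `{1, …, 83}` without the progressions that are asked for. -/
structure IsGood (χ : ℕ → ℕ) : Prop where
  lt_three : ∀ x, 1 ≤ x → x ≤ 83 → χ x < 3
  not_six : ∀ a d, 1 ≤ a → 1 ≤ d → a + 5 * d ≤ 83 → ¬ ∀ t < 6, χ (a + t * d) = 0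
  not_four : ∀ a d, 1 ≤ a → 1 ≤ d → a + 3 * d ≤ 83 → ¬ ∀ t < 4, χ (a + t * d) = 1
  not_two : ∀ x y, 1 ≤ x → x < y → y ≤ 83 → χ x = 2 → χ y ≠ 2

namespace IsGood

variable {χ : ℕ → ℕ}

lemma of_not_vdwProp
    (h : ∃ χ : ℕ → ℕ, (∀ x, 1 ≤ x → x ≤ 83 → χ x < 3) ∧
      ∀ i < 3, ∀ a, 1 ≤ a → ∀ d, 1 ≤ d → a + ([6, 4, 2].getD i 0 - 1) * d ≤ 83 →
        ¬ ∀ t < [6, 4, 2].getD i 0, χ (a + t * d) = i) : ∃ χ, IsGood χ := by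
  obtain ⟨χ, h₁, h₂⟩ := h
  refine ⟨χ, h₁, fun a d ha hd h => h₂ 0 (by omega) a ha d hd h,
    fun a d ha hd h => h₂ 1 (by omega) a ha d hd h, fun x y hx hxy hy h₃ h₄ => ?_⟩
  refine h₂ 2 (by omega) x hx (y - x) (by omega) ?_ fun t ht => ?_
  · change x + 1 * (y - x) ≤ 83
    omega
  · change t < 2 at ht
    interval_cases t
    · simpa using h₃
    · rw [one_mul, show x + (y - x) = y by omega]
      exact h₄

lemma reflect (hχ : IsGood χ) : IsGood fun x => χ (84 - x) where
  lt_three x h₁ h₂ := hχ.lt_three _ (by omega) (by omega)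
  not_six a d ha hd h₁ h₂ := hχ.not_six (84 - (a + 5 * d)) d (by omega) hd (by omega)
    fun t ht => by
      rw [← h₂ (5 - t) (by omega)]
      congr 1
      have h₃ : (5 - t) * d = 5 * d - t * d := Nat.sub_mul _ _ _
      have h₄ : t * d ≤ 5 * d := Nat.mul_le_mul_right _ (by omega)
      omega
  not_four a d ha hd h₁ h₂ := hχ.not_four (84 - (a + 3 * d)) d (by omega) hd (by omega)
    fun t ht => by
      rw [← h₂ (3 - t) (by omega)]
      congr 1
      have h₃ : (3 - t) * d = 3 * d - t * d := Nat.sub_mul _ _ _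
      have h₄ : t * d ≤ 3 * d := Nat.mul_le_mul_right _ (by omega)
      omega
  not_two x y hx hxy hy h₁ h₂ := hχ.not_two (84 - y) (84 - x) (by omega) (by omega) (by omega) h₂ h₁

lemma exists_ne_two (hχ : IsGood χ) :
    ∃ p, 1 ≤ p ∧ p ≤ 83 ∧ ∀ x, 1 ≤ x → x ≤ 83 → x ≠ p → χ x ≠ 2 := by
  by_cases h : ∃ p, 1 ≤ p ∧ p ≤ 83 ∧ χ p = 2
  · obtain ⟨p, h₁, h₂, h₃⟩ := h
    refine ⟨p, h₁, h₂, fun x hx hx' hne hx₂ => ?_⟩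
    rcases lt_or_gt_of_ne hne with hlt | hlt
    · exact hχ.not_two x p hx hlt h₂ hx₂ h₃
    · exact hχ.not_two p x h₁ hlt hx' h₃ hx₂
  · push Not at h
    exact ⟨1, by omega, by omega, fun x hx hx' _ => h x hx hx'⟩

/-- The coloring around the position `p`, which is moved to `h`. -/
lemma isColoring (hχ : IsGood χ) {p h : ℕ} {ws : List (ℕ × ℕ)}
    (hp : ∀ x, 1 ≤ x → x ≤ 83 → x ≠ p → χ x ≠ 2)
    (hw : ∃ w ∈ ws, h < w.1 + p ∧ w.2 + p ≤ 84 + h) :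
    Lanes.IsColoring h ws (fun y => h < y + p ∧ y + p ≤ 83 + h ∧ χ (y + p - h) = 0)
      (fun y => h < y + p ∧ y + p ≤ 83 + h ∧ χ (y + p - h) = 1) where
  not_six a d hd hP := by
    obtain ⟨h₁, -, -⟩ := hP 0 (by omega)
    obtain ⟨-, h₂, -⟩ := hP 5 (by omega)
    refine hχ.not_six (a + p - h) d (by omega) hd (by omega) fun t ht => ?_
    rw [← (hP t ht).2.2]
    congr 1
    omega
  not_four a d hd hP := by
    obtain ⟨h₁, -, -⟩ := hP 0 (by omega)
    obtain ⟨-, h₂, -⟩ := hP 3 (by omega)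
    refine hχ.not_four (a + p - h) d (by omega) hd (by omega) fun t ht => ?_
    rw [← (hP t ht).2.2]
    congr 1
    omega
  disjoint x h₀ h₁ := by omega
  exists_window := by
    obtain ⟨w, hw, h₁, h₂⟩ := hw
    refine ⟨w, hw, fun y h₃ h₄ h₅ => ?_⟩
    have h₆ := hχ.lt_three (y + p - h) (by omega) (by omega)
    have h₇ := hp (y + p - h) (by omega) (by omega) (by omega)
    omega

lemma not_of_refuted {p h : ℕ} {ws : List (ℕ × ℕ)} (hws : Lanes.Refuted h ws [] [])
    (hp : ∀ x, 1 ≤ x → x ≤ 83 → x ≠ p → χ x ≠ 2)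
    (hw : ∃ w ∈ ws, h < w.1 + p ∧ w.2 + p ≤ 84 + h) : ¬ IsGood χ :=
  fun hχ => hws _ _ (hχ.isColoring hp hw) (by simp) (by simp)

lemma not_of_le {p : ℕ} (h₁ : 1 ≤ p) (h₂ : p ≤ 42)
    (hp : ∀ x, 1 ≤ x → x ≤ 83 → x ≠ p → χ x ≠ 2) : ¬ IsGood χ := by
  rcases le_or_gt p 24 with h₃ | h₃
  · refine not_of_refuted Lanes.refuted_low hp ?_
    simp only [List.mem_cons, List.not_mem_nil, or_false, exists_eq_or_imp, exists_eq_left]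
    omega
  rcases le_or_gt p 33 with h₄ | h₄
  · refine not_of_refuted Lanes.refuted_middle hp ?_
    simp only [List.mem_cons, List.not_mem_nil, or_false, exists_eq_or_imp, exists_eq_left]
    omega
  · refine not_of_refuted Lanes.refuted_high hp ?_
    simp only [List.mem_cons, List.not_mem_nil, or_false, exists_eq_or_imp, exists_eq_left]
    omega

end IsGood

theorem not_isGood (χ : ℕ → ℕ) : ¬ IsGood χ := by
  intro hχ
  obtain ⟨p, h₁, h₂, hp⟩ := hχ.exists_ne_two
  rcases le_or_gt p 42 with h₃ | h₃
  · exact IsGood.not_of_le h₁ h₃ hp hχ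
  · exact IsGood.not_of_le (p := 84 - p) (by omega) (by omega)
      (fun x hx hx' hne => hp _ (by omega) (by omega) (by omega)) hχ.reflect

/-! ### The lower bound -/

/-- A coloring of `{1, …, 82}` that avoids the progressions. -/
def extremalColoring (x : ℕ) : ℕ :=
  if x = 33 then 2 else if Nat.testBit 310059522621148850409544 x then 1 else 0

lemma extremalColoring_six : ∀ a < 83, ∀ d < 83, 1 ≤ a ∧ 1 ≤ d ∧ a + 5 * d ≤ 82 →
    ¬ ∀ t < 6, extremalColoring (a + t * d) = 0 := by
  decide +kernel

lemma extremalColoring_four : ∀ a < 83, ∀ d < 83, 1 ≤ a ∧ 1 ≤ d ∧ a + 3 * d ≤ 82 →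
    ¬ ∀ t < 4, extremalColoring (a + t * d) = 1 := by
  decide +kernel

lemma eq_of_extremalColoring_eq_two {x : ℕ} (hx : extremalColoring x = 2) : x = 33 := by
  unfold extremalColoring at hx
  split_ifs at hx <;> omega

/-- The van der Waerden number `w(6,4,2;3)` equals `83`: it is the least positive
integer `n` such that every `3`-coloring of `{1,...,n}` admits a monochromatic
arithmetic progression of the prescribed length in the prescribed color. -/
theorem vdw_value :
    IsLeast {n : ℕ | 0 < n ∧ vdwProp 3 (fun i => [6, 4, 2].getD i 0) n} 83 := by
  refine ⟨⟨by norm_num, ?_⟩, ?_⟩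
  · by_contra h
    unfold vdwProp at h
    push Not at h
    obtain ⟨χ, hχ, h⟩ := h
    obtain ⟨χ', hχ'⟩ := IsGood.of_not_vdwProp ⟨χ, hχ, fun i hi a ha d hd hle hall => by
      obtain ⟨t, ht, hne⟩ := h i hi a ha d hd hle
      exact hne (hall t ht)⟩
    exact not_isGood χ' hχ'
  · rintro n ⟨-, hn⟩
    by_contra! hlt
    obtain ⟨i, hi, a, ha, d, hd, hle, hall⟩ := hn extremalColoring fun x _ _ => by
      unfold extremalColoring
      split_ifs <;> omega
    interval_cases i
    · change a + 5 * d ≤ n at hle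
      exact extremalColoring_six a (by omega) d (by omega) ⟨ha, hd, by omega⟩ hall
    · change a + 3 * d ≤ n at hle
      exact extremalColoring_four a (by omega) d (by omega) ⟨ha, hd, by omega⟩ hall
    · have h₀ := eq_of_extremalColoring_eq_two (hall 0 (by norm_num))
      have h₁ := eq_of_extremalColoring_eq_two (hall 1 (by norm_num))
      omega
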